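/- For every ξ ∈ Cr(X): (i) there exists a sequence (x_n) of spherical residues with ξ(x_n) = x_n for all n which penetrates and eventually remains in every combinatorial sector pointing to ξ; (ii) every such sequence converges to ξ in Cr(X). In particular, every point of Cr(X) is the limit of a sequence of spherical residues all lying in a common apartment, i.e. Cr(X) is the union of the sets Cr(A) over all apartments A of X. -/

import Mathlib

open Filter Topology

noncomputable section

variable {B : Type} {W : Type} [Group W] {M : CoxeterMatrix B}

/-- The subset `I` of the simple reflections is of *spherical type* if the standard
parabolic subgroup `W_I` it generates is finite. -/
def SphType (cs : CoxeterSystem M W) (I : Set B) : Prop :=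
  ((Subgroup.closure (cs.simple '' I) : Subgroup W) : Set W).Finite

/-- A building of type `(W,S)`, in the chamber-system (`W`-metric) approach:
a nonempty set of chambers with a Weyl-group-valued distance function `delta`. -/
structure Bldg (cs : CoxeterSystem M W) where
  Chamber : Type
  chamber_nonempty : Nonempty Chamber
  delta : Chamber → Chamber → W
  delta_eq_one_iff : ∀ C D, delta C D = 1 ↔ C = D
  delta_mem_pair : ∀ C D E (i : B), delta D E = cs.simple i →
    delta C E = delta C D * cs.simple i ∨ delta C E = delta C D
  delta_eq_of_length : ∀ C D E (i : B), delta D E = cs.simple i →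
    cs.length (delta C D * cs.simple i) = cs.length (delta C D) + 1 →
    delta C E = delta C D * cs.simple i
  exists_delta : ∀ C D (i : B), ∃ E, delta D E = cs.simple i ∧
    delta C E = delta C D * cs.simple i

namespace Bldg

variable {cs : CoxeterSystem M W} (X : Bldg cs)

instance : Nonempty X.Chamber := X.chamber_nonempty

instance : TopologicalSpace X.Chamber := ⊥
instance : DiscreteTopology X.Chamber := ⟨rfl⟩

/-- The gallery distance between two chambers. -/
def gdist (C D : X.Chamber) : ℕ := cs.length (X.delta C D)

/-- The `I`-residue of the chamber `C`. -/
def residue (I : Set B) (C : X.Chamber) : Set X.Chamber :=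
  {D | X.delta C D ∈ Subgroup.closure (cs.simple '' I)}

/-- `R` is a spherical residue. -/
def IsSphResidue (R : Set X.Chamber) : Prop :=
  ∃ (I : Set B) (C : X.Chamber), SphType cs I ∧ R = X.residue I C

/-- `R` is a panel, i.e. an `{s}`-residue. -/
def IsPanel (R : Set X.Chamber) : Prop :=
  ∃ (i : B) (C : X.Chamber), R = X.residue {i} C

/-- The set `Res(X)` of spherical residues of `X`. -/
def Res : Type := {R : Set X.Chamber // X.IsSphResidue R}

/-- The set of panels of `X`. -/
def Panel : Type := {R : Set X.Chamber // X.IsPanel R}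

instance : Nonempty X.Res := by
  obtain ⟨C⟩ := X.chamber_nonempty
  exact ⟨⟨X.residue ∅ C, ∅, C, by simp [SphType], rfl⟩⟩

instance : TopologicalSpace X.Res := ⊥
instance : DiscreteTopology X.Res := ⟨rfl⟩

/-- `R₁ ≤ R₂` : the spherical residue `R₂` contains `R₁`, i.e. `R₂ ⊆ R₁` as
sets of chambers. -/
def leRes (R₁ R₂ : X.Res) : Prop := R₂.1 ⊆ R₁.1

/-- The star `St(σ)` of a spherical residue. -/
def star (σ : X.Res) : Set X.Res := {τ | X.leRes σ τ}

/-- The gate (combinatorial projection) of the chamber `C` onto the residue `R` :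
the unique chamber of `R` through which pass minimal galleries from `C` to any
chamber of `R`. -/
def gate (R : Set X.Chamber) (C : X.Chamber) : X.Chamber :=
  Classical.epsilon fun D => D ∈ R ∧ ∀ E ∈ R, X.gdist C E = X.gdist C D + X.gdist D E

/-- The combinatorial projection of the residue `T` onto the residue `R`,
as a set of chambers. -/
def projSet (R T : Set X.Chamber) : Set X.Chamber := X.gate R '' T

/-- The combinatorial projection `proj_R(T)` of the spherical residue `T` onto
the spherical residue `R`, as a spherical residue. -/
def projRes (R T : X.Res) : X.Res :=
  Classical.epsilon fun U : X.Res => U.1 = X.projSet R.1 T.1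

/-- The map `proj_r : Res(X) → ∏_σ St(σ)` underlying the maximal combinatorial
bordification. -/
def projr (R : X.Res) : X.Res → X.Res := fun σ => X.projRes σ R

/-- The maximal combinatorial bordification `Cr(X)`: the closure of the image
of `proj_r`, each factor of the product being discrete. -/
def Cr : Set (X.Res → X.Res) := closure (Set.range X.projr)

/-- The map `proj_c : ch(X) → ∏_{σ panel} St(σ)` underlying the minimal
combinatorial bordification. -/
def projc (C : X.Chamber) : X.Panel → X.Chamber := fun σ => X.gate σ.1 C

/-- The minimal combinatorial bordification `Cc(X)`. -/
def Cc : Set (X.Panel → X.Chamber) := closure (Set.range X.projc)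

/-- A set of spherical residues is closed if it contains, with any residue,
all residues that it contains (in the order `leRes`). -/
def ClosedResSet (𝓡 : Set X.Res) : Prop :=
  ∀ R₁ R₂ : X.Res, X.leRes R₁ R₂ → R₂ ∈ 𝓡 → R₁ ∈ 𝓡

/-- A set of spherical residues is convex if it is closed and stable under
combinatorial projections. -/
def ConvexResSet (𝓡 : Set X.Res) : Prop :=
  X.ClosedResSet 𝓡 ∧ ∀ R₁ ∈ 𝓡, ∀ R₂ ∈ 𝓡, X.projRes R₁ R₂ ∈ 𝓡

/-- The closure of a set of spherical residues. -/
def resClosure (𝓡 : Set X.Res) : Set X.Res := ⋂₀ {𝓢 | X.ClosedResSet 𝓢 ∧ 𝓡 ⊆ 𝓢}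

/-- The convex hull of a set of spherical residues. -/
def convHull (𝓡 : Set X.Res) : Set X.Res := ⋂₀ {𝓢 | X.ConvexResSet 𝓢 ∧ 𝓡 ⊆ 𝓢}

/-- The convex hull `Conv(R₁,R₂)` of two spherical residues. -/
def conv2 (R₁ R₂ : X.Res) : Set X.Res := X.convHull {R₁, R₂}

/-- `α : W → ch(X)` is an apartment map: an isometric embedding of the Coxeter
complex. -/
def IsApartMap (α : W → X.Chamber) : Prop :=
  Function.Injective α ∧ ∀ v w : W, X.delta (α v) (α w) = v⁻¹ * w

/-- `A` is an apartment of `X`. -/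
def IsApartment (A : Set X.Chamber) : Prop :=
  ∃ α : W → X.Chamber, X.IsApartMap α ∧ A = Set.range α

/-- The residue `R` lies in the apartment `A`. -/
def LiesIn (R : X.Res) (A : Set X.Chamber) : Prop := (R.1 ∩ A).Nonempty

/-- `φ` is a root (half-apartment) of the apartment `A`. -/
def IsRootOf (A φ : Set X.Chamber) : Prop :=
  ∃ α : W → X.Chamber, X.IsApartMap α ∧ A = Set.range α ∧
    ∃ t : W, cs.IsReflection t ∧ φ = α '' {v : W | cs.length v < cs.length (t * v)}

/-- The residue `R` is contained in the root `φ` of the apartment `A`. -/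
def ContainedInRoot (R : X.Res) (A φ : Set X.Chamber) : Prop := R.1 ∩ A ⊆ φ

/-- `Φ_A(R₁,R₂)`: the set of roots of `A` containing `R₁` but not `R₂`. -/
def PhiSep (A : Set X.Chamber) (R₁ R₂ : X.Res) : Set (Set X.Chamber) :=
  {φ | X.IsRootOf A φ ∧ X.ContainedInRoot R₁ A φ ∧ ¬ X.ContainedInRoot R₂ A φ}

/-- A choice of apartment in which both `R₁` and `R₂` lie. -/
def chooseApt (R₁ R₂ : X.Res) : Set X.Chamber :=
  Classical.epsilon fun A : Set X.Chamber => X.IsApartment A ∧ X.LiesIn R₁ A ∧ X.LiesIn R₂ A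

/-- The root-distance between two spherical residues:
`d(R₁,R₂) = ½|Φ_A(R₁,R₂)| + ½|Φ_A(R₂,R₁)|` for an apartment `A` containing both. -/
def rootDist (R₁ R₂ : X.Res) : ℝ :=
  (((X.PhiSep (X.chooseApt R₁ R₂) R₁ R₂).ncard +
    (X.PhiSep (X.chooseApt R₁ R₂) R₂ R₁).ncard : ℕ) : ℝ) / 2

/-- The interval `[R₁,R₂]` determined by two spherical residues. -/
def interval (R₁ R₂ : X.Res) : Set X.Res :=
  {σ | X.rootDist R₁ R₂ = X.rootDist R₁ σ + X.rootDist σ R₂}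

/-- The retraction onto the apartment given by the apartment map `α`, centred at
the chamber `α 1`. -/
def retr (α : W → X.Chamber) (D : X.Chamber) : X.Chamber := α (X.delta (α 1) D)

/-- The retraction onto an apartment, acting on spherical residues: it maps the
`I`-residue of a chamber `D` to the `I`-residue of the retracted chamber. -/
def retrRes (α : W → X.Chamber) (R : X.Res) : X.Res :=
  Classical.epsilon fun T : X.Res =>
    ∃ (I : Set B) (D : X.Chamber), R.1 = X.residue I D ∧ T.1 = X.residue I (X.retr α D)

/-- The sequence `(R_n)` of spherical residues converges to `ξ` in the maximal
combinatorial bordification. -/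
def ConvSeq (ξ : X.Res → X.Res) (R : ℕ → X.Res) : Prop :=
  Tendsto (fun n => X.projr (R n)) atTop (nhds ξ)

/-- `Q(x, (R_n)) = ⋃_k ⋂_{n ≥ k} Conv(x, R_n)`. -/
def Qseq (x : X.Res) (R : ℕ → X.Res) : Set X.Res :=
  ⋃ k : ℕ, ⋂ n : ℕ, ⋂ _ : k ≤ n, X.conv2 x (R n)

/-- The combinatorial sector `Q(x,ξ)` based at `x` and pointing towards `ξ`. -/
def Qsector (x : X.Res) (ξ : X.Res → X.Res) : Set X.Res :=
  X.Qseq x (Classical.epsilon (X.ConvSeq ξ))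

/-- `Φ_A(ξ)`: the set of roots of the apartment `A` (with apartment map `α`) in
which every sequence of residues converging to `ξ`, retracted to `A`, eventually
lies. -/
def PhiXi (A : Set X.Chamber) (α : W → X.Chamber) (ξ : X.Res → X.Res) :
    Set (Set X.Chamber) :=
  {φ | X.IsRootOf A φ ∧ ∀ R : ℕ → X.Res, X.ConvSeq ξ R →
    ∃ N : ℕ, ∀ n > N, X.ContainedInRoot (X.retrRes α (R n)) A φ}

/-- `Φ_A(x)`: the set of roots of `A` containing the residue `x`. -/
def PhiRes (A : Set X.Chamber) (x : X.Res) : Set (Set X.Chamber) :=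
  {φ | X.IsRootOf A φ ∧ X.ContainedInRoot x A φ}

/-- The spherical residue `x` is a chamber (an `∅`-residue). -/
def IsChamberRes (x : X.Res) : Prop :=
  ∃ C : X.Chamber, x.1 = X.residue (∅ : Set B) C

/-- The automorphism group of the building: all permutations of the chambers
preserving the Weyl distance. -/
def autGroup : Subgroup (Equiv.Perm X.Chamber) where
  carrier := {g | ∀ C D : X.Chamber, X.delta (g C) (g D) = X.delta C D}
  one_mem' := by intro C D; simp
  mul_mem' := by
    intro a b ha hb C D
    simp only [Equiv.Perm.mul_apply]
    rw [ha, hb]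
  inv_mem' := by
    intro a ha C D
    have := ha (a⁻¹ C) (a⁻¹ D)
    simpa using this.symm

/-- `Aut(X)` as a type. -/
abbrev Aut : Type := ↥X.autGroup

/-- The topology of pointwise convergence on `Aut(X)` (the chamber set being
discrete). -/
instance : TopologicalSpace X.Aut :=
  TopologicalSpace.induced
    (fun g : X.Aut => ((g : Equiv.Perm X.Chamber) : X.Chamber → X.Chamber)) inferInstance

/-- The action of an automorphism on spherical residues. -/
def actRes (g : X.Aut) (R : X.Res) : X.Res :=
  Classical.epsilon fun T : X.Res => T.1 = (g : Equiv.Perm X.Chamber) '' R.1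

/-- The action of an automorphism on panels. -/
def actPanel (g : X.Aut) (σ : X.Panel) : X.Panel :=
  haveI : Nonempty X.Panel := ⟨σ⟩
  Classical.epsilon fun τ : X.Panel => τ.1 = (g : Equiv.Perm X.Chamber) '' σ.1

/-- The action of `Aut(X)` on the maximal combinatorial bordification:
`(g·f)(σ) = g·f(g⁻¹σ)`. -/
def actCr (g : X.Aut) (f : X.Res → X.Res) : X.Res → X.Res :=
  fun σ => X.actRes g (f (X.actRes g⁻¹ σ))

/-- The action of `Aut(X)` on the minimal combinatorial bordification. -/
def actCc (g : X.Aut) (f : X.Panel → X.Chamber) : X.Panel → X.Chamber :=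
  fun σ => (g : Equiv.Perm X.Chamber) (f (X.actPanel g⁻¹ σ))

/-- The building is locally finite: `S` is finite and panels are finite. -/
def LocallyFinite : Prop :=
  Finite B ∧ ∀ R : Set X.Chamber, X.IsPanel R → R.Finite

/-- The building is thick: every panel contains at least three chambers. -/
def Thick : Prop := ∀ R : Set X.Chamber, X.IsPanel R → 3 ≤ R.ncard

/-- The subgroup `G ≤ Aut(X)` acts strongly transitively: transitively on pairs
`(C, A)` of a chamber contained in an apartment. -/
def StronglyTransitive (G : Subgroup X.Aut) : Prop :=
  ∀ (C C' : X.Chamber) (A A' : Set X.Chamber),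
    X.IsApartment A → C ∈ A → X.IsApartment A' → C' ∈ A' →
    ∃ g ∈ G, (g : Equiv.Perm X.Chamber) C = C' ∧ (g : Equiv.Perm X.Chamber) '' A = A'

end Bldg

/-- A topological group is amenable if there is a left-invariant mean on the
space of bounded continuous real-valued functions on it. -/
def IsAmenableGroup (H : Type*) [Group H] [TopologicalSpace H] : Prop :=
  ∃ m : BoundedContinuousFunction H ℝ →ₗ[ℝ] ℝ,
    m 1 = 1 ∧ (∀ f : BoundedContinuousFunction H ℝ, (∀ x, 0 ≤ f x) → 0 ≤ m f) ∧
    ∀ (g : H) (f₁ f₂ : BoundedContinuousFunction H ℝ),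
      (∀ x, f₂ x = f₁ (g * x)) → m f₂ = m f₁

/-- A subset `K` of a topological group is topologically locally finite if every
finite subset of `K` generates a subgroup with compact closure. -/
def IsTLFSet {H : Type*} [Group H] [TopologicalSpace H] (K : Set H) : Prop :=
  ∀ s : Finset H, (s : Set H) ⊆ K →
    IsCompact (closure ((Subgroup.closure (s : Set H) : Subgroup H) : Set H))

/-- The space of closed subgroups of a topological group. -/
def ChabautySpace (H : Type*) [Group H] [TopologicalSpace H] : Type _ :=
  {K : Subgroup H // IsClosed (K : Set H)}

instance {H : Type*} [Group H] [TopologicalSpace H] : Nonempty (ChabautySpace H) :=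
  ⟨⟨⊤, by rw [Subgroup.coe_top]; exact isClosed_univ⟩⟩

/-- The Chabauty topology on the space of closed subgroups. -/
instance {H : Type*} [Group H] [TopologicalSpace H] : TopologicalSpace (ChabautySpace H) :=
  TopologicalSpace.generateFrom
    ({s | ∃ K : Set H, IsCompact K ∧ s = {L : ChabautySpace H | (L.1 : Set H) ∩ K = ∅}} ∪
     {s | ∃ U : Set H, IsOpen U ∧ s = {L : ChabautySpace H | ((L.1 : Set H) ∩ U).Nonempty}})

namespace Bldg

variable {cs : CoxeterSystem M W} (X : Bldg cs)

/-- The stabiliser in `G` of a spherical residue, as a set. -/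
def gstab (G : Subgroup X.Aut) (R : X.Res) : Set ↥G :=
  {g : ↥G | X.actRes (g : X.Aut) R = R}

/-- The stabiliser in `G` of a spherical residue, as a closed subgroup of `G`. -/
def gstabC (G : Subgroup X.Aut) (R : X.Res) : ChabautySpace ↥G :=
  Classical.epsilon fun L : ChabautySpace ↥G => (L.1 : Set ↥G) = X.gstab G R

/-- `D_ξ`: the union over `x ∈ Res(X)` of the pointwise fixators in `G` of the
combinatorial sectors `Q(x,ξ)`. -/
def gfixSector (G : Subgroup X.Aut) (ξ : X.Res → X.Res) : Set ↥G :=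
  {g : ↥G | ∃ x : X.Res, ∀ R ∈ X.Qsector x ξ, X.actRes (g : X.Aut) R = R}

/-- `D_ξ` as a closed subgroup of `G` (an element of the Chabauty space). -/
def DxiC (G : Subgroup X.Aut) (ξ : X.Res → X.Res) : ChabautySpace ↥G :=
  Classical.epsilon fun L : ChabautySpace ↥G => (L.1 : Set ↥G) = X.gfixSector G ξ

/-- The set of periodic elements of the stabiliser `G_ξ`. -/
def periodicStab (G : Subgroup X.Aut) (ξ : X.Res → X.Res) : Set ↥G :=
  {g : ↥G | X.actCr (g : X.Aut) ξ = ξ ∧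
    IsCompact (closure ((Subgroup.zpowers g : Subgroup ↥G) : Set ↥G))}

/-- The horofunction compactification of the chamber graph, with base point `y₀`. -/
def horoCh (y₀ : X.Chamber) : Set (X.Chamber → ℝ) :=
  closure (Set.range fun C : X.Chamber =>
    fun y : X.Chamber => (X.gdist C y : ℝ) - (X.gdist C y₀ : ℝ))

/-- The horofunction compactification of `(Res(X), root-distance)`, with base
point `z₀`. -/
def horoRes (z₀ : X.Res) : Set (X.Res → ℝ) :=
  closure (Set.range fun R : X.Res =>
    fun y : X.Res => X.rootDist R y - X.rootDist R z₀)

/-- The action of `Aut(X)` on horofunctions of the chamber graph. -/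
def actHoroCh (y₀ : X.Chamber) (g : X.Aut) (h : X.Chamber → ℝ) : X.Chamber → ℝ :=
  fun y => h (((g⁻¹ : X.Aut) : Equiv.Perm X.Chamber) y) -
    h (((g⁻¹ : X.Aut) : Equiv.Perm X.Chamber) y₀)

/-- The action of `Aut(X)` on horofunctions of `(Res(X), root-distance)`. -/
def actHoroRes (z₀ : X.Res) (g : X.Aut) (h : X.Res → ℝ) : X.Res → ℝ :=
  fun y => h (X.actRes g⁻¹ y) - h (X.actRes g⁻¹ z₀)

end Bldg

namespace CoxeterSystem

variable (cs : CoxeterSystem M W)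

open Classical in
/-- The permutation of `W × ZMod 2` attached to a simple reflection `s`: it conjugates the first
coordinate by `s` and flips the second one exactly when the first one is `s`. -/
def signPerm (i : B) : Equiv.Perm (W × ZMod 2) where
  toFun p := (cs.simple i * p.1 * cs.simple i, p.2 + if p.1 = cs.simple i then 1 else 0)
  invFun p := (cs.simple i * p.1 * cs.simple i, p.2 + if p.1 = cs.simple i then 1 else 0)
  left_inv p := by
    obtain ⟨t, e⟩ := p
    have h : (cs.simple i * t * cs.simple i = cs.simple i) ↔ t = cs.simple i := by
      constructor
      · intro h
        have := congrArg (fun x => cs.simple i * x * cs.simple i) h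
        simpa [mul_assoc] using this
      · rintro rfl; simp
    have h2 : (1 + 1 : ZMod 2) = 0 := rfl
    ext <;> simp only [h]
    · simp [mul_assoc]
    · split_ifs <;> simp [add_assoc, h2]
  right_inv p := by
    obtain ⟨t, e⟩ := p
    have h : (cs.simple i * t * cs.simple i = cs.simple i) ↔ t = cs.simple i := by
      constructor
      · intro h
        have := congrArg (fun x => cs.simple i * x * cs.simple i) h
        simpa [mul_assoc] using this
      · rintro rfl; simp
    have h2 : (1 + 1 : ZMod 2) = 0 := rfl
    ext <;> simp only [h]
    · simp [mul_assoc]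
    · split_ifs <;> simp [add_assoc, h2]

open Classical in
theorem signPerm_mul_pow (i j : B) (n : ℕ) (t : W) (e : ZMod 2) :
    ((cs.signPerm i * cs.signPerm j) ^ n) (t, e) =
      ((cs.simple i * cs.simple j) ^ n * t * ((cs.simple i * cs.simple j) ^ n)⁻¹,
        e + ∑ l ∈ Finset.range (2 * n),
          if t = cs.simple j * (cs.simple i * cs.simple j) ^ l then 1 else 0) := by
  induction n with
  | zero => simp
  | succ n ih =>
    rw [pow_succ', Equiv.Perm.mul_apply, ih]
    set r := cs.simple i * cs.simple j with hr
    have hjr : cs.simple j * r * cs.simple j = r⁻¹ := by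
      simp [hr, mul_assoc]
    have hjrn : ∀ k : ℕ, cs.simple j * r ^ k * cs.simple j = (r ^ k)⁻¹ := by
      intro k
      induction k with
      | zero => simp
      | succ k ihk =>
        have : cs.simple j * r ^ (k + 1) * cs.simple j
            = (cs.simple j * r ^ k * cs.simple j) * (cs.simple j * r * cs.simple j) := by
          simp [pow_succ, mul_assoc]
        rw [this, ihk, hjr, ← mul_inv_rev, pow_succ']
    have hj' : ∀ k : ℕ, (r ^ k)⁻¹ * cs.simple j = cs.simple j * r ^ k := by
      intro k; rw [← hjrn k]; simp [mul_assoc]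
    have e1 : (r ^ n * t * (r ^ n)⁻¹ = cs.simple j) ↔ t = cs.simple j * r ^ (2 * n) := by
      have : cs.simple j * r ^ (2 * n) = (r ^ n)⁻¹ * cs.simple j * r ^ n := by
        rw [hj', two_mul, pow_add, mul_assoc]
      rw [this]
      constructor
      · intro h; rw [← h]; group
      · rintro rfl; group
    have e2 : (cs.simple j * (r ^ n * t * (r ^ n)⁻¹) * cs.simple j = cs.simple i) ↔
        t = cs.simple j * r ^ (2 * n + 1) := by
      have : cs.simple j * r ^ (2 * n + 1) =
          (r ^ n)⁻¹ * (cs.simple j * cs.simple i * cs.simple j) * r ^ n := by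
        have h3 : cs.simple j * cs.simple i * cs.simple j = cs.simple j * r := by
          simp [hr, mul_assoc]
        rw [h3, ← mul_assoc, hj', mul_assoc, mul_assoc, ← pow_succ', ← pow_add]
        congr 2; ring
      rw [this]
      constructor
      · intro h; rw [← h]; simp [mul_assoc]
      · rintro rfl; simp [mul_assoc]
    have e3 : ∀ (p : W × ZMod 2), (cs.signPerm i * cs.signPerm j) p =
        (cs.simple i * (cs.simple j * p.1 * cs.simple j) * cs.simple i,
          p.2 + (if p.1 = cs.simple j then 1 else 0) +
            if cs.simple j * p.1 * cs.simple j = cs.simple i then 1 else 0) := fun p => rfl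
    rw [e3]
    simp only [e1, e2]
    rw [show 2 * (n + 1) = 2 * n + 1 + 1 by ring, Finset.sum_range_succ, Finset.sum_range_succ]
    ext
    · simp [pow_succ', hr, mul_assoc]
    · simp only [add_assoc]

theorem signPerm_isLiftable : M.IsLiftable cs.signPerm := by
  classical
  intro i j
  ext1 ⟨t, e⟩
  rw [signPerm_mul_pow, cs.simple_mul_simple_pow]
  simp only [one_mul, inv_one, mul_one, Equiv.Perm.coe_one, id_eq, Prod.mk.injEq, true_and,
    add_eq_left]
  rw [two_mul, Finset.sum_range_add]
  simp only [pow_add, cs.simple_mul_simple_pow, one_mul]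
  exact CharTwo.add_self_eq_zero _

/-- The action of `W` on `W × ZMod 2` extending `signPerm`. -/
def signHom : W →* Equiv.Perm (W × ZMod 2) := cs.lift ⟨cs.signPerm, cs.signPerm_isLiftable⟩

theorem signHom_simple (i : B) : cs.signHom (cs.simple i) = cs.signPerm i :=
  cs.lift_apply_simple cs.signPerm_isLiftable i

open Classical in
theorem signHom_wordProd (ω : List B) (t : W) (e : ZMod 2) :
    cs.signHom (cs.wordProd ω) (t, e) = (cs.wordProd ω * t * (cs.wordProd ω)⁻¹,
      e + ((cs.rightInvSeq ω).count t : ZMod 2)) := by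
  induction ω with
  | nil => simp
  | cons i ω ih =>
    rw [wordProd_cons, map_mul, Equiv.Perm.mul_apply, ih, signHom_simple]
    change (_, _) = _
    have h : cs.wordProd ω * t * (cs.wordProd ω)⁻¹ = cs.simple i ↔
        (cs.wordProd ω)⁻¹ * cs.simple i * cs.wordProd ω = t := by
      constructor
      · intro h; rw [← h]; group
      · rintro rfl; group
    ext
    · simp [mul_assoc]
    · simp only [h, rightInvSeq, List.count_cons, beq_iff_eq, Nat.cast_add, Nat.cast_ite,
        Nat.cast_one, Nat.cast_zero, add_assoc]

/-- The mod `2` multiplicity of `t` in the left inversion sequence of any word for `w`. -/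
def invSign (w t : W) : ZMod 2 := (cs.signHom w⁻¹ (t, 0)).2

theorem signHom_apply (w t : W) (e : ZMod 2) :
    cs.signHom w (t, e) = (w * t * w⁻¹, e + cs.invSign w⁻¹ t) := by
  obtain ⟨ω, -, rfl⟩ := cs.exists_isReduced w
  rw [invSign, inv_inv, signHom_wordProd, signHom_wordProd]
  simp

theorem invSign_mul (x y t : W) :
    cs.invSign (x * y) t = cs.invSign x t + cs.invSign y (x⁻¹ * t * x) := by
  rw [invSign, mul_inv_rev, map_mul, Equiv.Perm.mul_apply, signHom_apply, signHom_apply]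
  simp

open Classical in
theorem invSign_wordProd (ω : List B) (t : W) :
    cs.invSign (cs.wordProd ω) t = ((cs.leftInvSeq ω).count t : ZMod 2) := by
  rw [invSign, ← wordProd_reverse, signHom_wordProd, rightInvSeq_reverse, List.count_reverse]
  simp

theorem mem_leftInvSeq_of_invSign_ne_zero {ω : List B} {t : W}
    (h : cs.invSign (cs.wordProd ω) t ≠ 0) : t ∈ cs.leftInvSeq ω := by
  classical
  by_contra hn
  rw [invSign_wordProd, List.count_eq_zero_of_not_mem hn] at h
  simp at h

theorem invSign_one (t : W) : cs.invSign 1 t = 0 := by simp [invSign]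

theorem invSign_self {t : W} (ht : cs.IsReflection t) : cs.invSign t t = 1 := by
  obtain ⟨x, i, rfl⟩ := ht
  have h1 := cs.invSign_mul x x⁻¹ (x * cs.simple i * x⁻¹)
  rw [mul_inv_cancel, invSign_one] at h1
  have h2 : cs.invSign (cs.simple i) (cs.simple i) = 1 := by
    classical
    simpa using cs.invSign_wordProd [i] (cs.simple i)
  rw [mul_assoc, invSign_mul, invSign_mul]
  have e1 : x⁻¹ * (x * (cs.simple i * x⁻¹)) * x = cs.simple i := by simp [mul_assoc]
  have e2 : x⁻¹ * (x * cs.simple i * x⁻¹) * x = cs.simple i := by simp [mul_assoc]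
  rw [e1, h2]
  rw [e2] at h1
  rw [← mul_assoc x]
  simp only [inv_simple, simple_mul_simple_self, one_mul]
  rw [add_left_comm, ← h1, add_zero]

theorem isLeftInversion_iff_invSign {w t : W} (ht : cs.IsReflection t) :
    cs.IsLeftInversion w t ↔ cs.invSign w t = 1 := by
  have key : ∀ w, cs.invSign w t ≠ 0 → cs.IsLeftInversion w t := by
    intro w h
    obtain ⟨ω, hω, rfl⟩ := cs.exists_isReduced w
    exact cs.isLeftInversion_of_mem_leftInvSeq hω (cs.mem_leftInvSeq_of_invSign_ne_zero h)
  constructor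
  · intro h
    by_contra hn
    have h0 : cs.invSign w t = 0 := by
      generalize cs.invSign w t = z at hn ⊢
      revert z; decide
    have h1 : cs.invSign (t * w) t ≠ 0 := by
      rw [invSign_mul, cs.invSign_self ht]
      simp [h0]
    have h2 := (key _ h1).2
    rw [← mul_assoc, ht.mul_self, one_mul] at h2
    exact absurd h.2 (by omega)
  · intro h
    exact key w (by rw [h]; decide)

theorem isLeftInversion_mul_iff {x y t : W} (ht : cs.IsReflection t) :
    cs.IsLeftInversion (x * y) t ↔
      (cs.IsLeftInversion x t ↔ ¬ cs.IsLeftInversion y (x⁻¹ * t * x)) := by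
  have ht' : cs.IsReflection (x⁻¹ * t * x) := by simpa using ht.conj x⁻¹
  rw [isLeftInversion_iff_invSign _ ht, isLeftInversion_iff_invSign _ ht,
    isLeftInversion_iff_invSign _ ht', invSign_mul]
  generalize cs.invSign x t = a
  generalize cs.invSign y _ = b
  revert a b; decide

theorem mem_leftInvSeq_of_isLeftInversion {ω : List B} {t : W}
    (h : cs.IsLeftInversion (cs.wordProd ω) t) : t ∈ cs.leftInvSeq ω := by
  apply cs.mem_leftInvSeq_of_invSign_ne_zero
  rw [(cs.isLeftInversion_iff_invSign h.1).1 h]; decide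

/-- The set of left inversions of `w`. -/
def invSet (w : W) : Set W := {t | cs.IsLeftInversion w t}

theorem invSet_wordProd {ω : List B} (hω : cs.IsReduced ω) :
    cs.invSet (cs.wordProd ω) = {t | t ∈ cs.leftInvSeq ω} :=
  Set.ext fun _ => ⟨cs.mem_leftInvSeq_of_isLeftInversion,
    cs.isLeftInversion_of_mem_leftInvSeq hω⟩

theorem invSet_finite (w : W) : (cs.invSet w).Finite := by
  obtain ⟨ω, hω, rfl⟩ := cs.exists_isReduced w
  rw [invSet_wordProd cs hω]
  exact List.finite_toSet _

theorem ncard_invSet (w : W) : (cs.invSet w).ncard = cs.length w := by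
  classical
  obtain ⟨ω, hω, rfl⟩ := cs.exists_isReduced w
  rw [invSet_wordProd cs hω, hω.eq, ← cs.length_leftInvSeq ω,
    ← List.toFinset_card_of_nodup hω.nodup_leftInvSeq, ← Set.ncard_coe_finset]
  congr 1; ext; simp

theorem not_isLeftInversion_one (t : W) : ¬ cs.IsLeftInversion 1 t := fun h => by
  simpa using h.2

theorem isReflection_conj_inv {t : W} (ht : cs.IsReflection t) (x : W) :
    cs.IsReflection (x⁻¹ * t * x) := by simpa using ht.conj x⁻¹

theorem isLeftInversion_inv_mul_iff {x y t : W} (ht : cs.IsReflection t) :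
    cs.IsLeftInversion (x⁻¹ * y) (x⁻¹ * t * x) ↔
      (cs.IsLeftInversion x t ↔ ¬ cs.IsLeftInversion y t) := by
  have := cs.isLeftInversion_mul_iff (x := x) (y := x⁻¹ * y) ht
  rw [mul_inv_cancel_left] at this
  tauto

theorem length_inv_mul_eq_ncard (x y : W) :
    cs.length (x⁻¹ * y) = (symmDiff (cs.invSet x) (cs.invSet y)).ncard := by
  rw [← ncard_invSet, ← Set.ncard_image_of_injective (symmDiff _ _) (MulAut.conj x⁻¹).injective]
  congr 1
  ext t
  simp only [Set.mem_image, MulAut.conj_apply, inv_inv]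
  constructor
  · intro h
    have ht : cs.IsReflection t := h.1
    refine ⟨x * t * x⁻¹, ?_, by group⟩
    have := cs.isLeftInversion_inv_mul_iff (x := x) (y := y) (ht.conj x)
    rw [show x⁻¹ * (x * t * x⁻¹) * x = t by group] at this
    rw [Set.mem_symmDiff]
    simp only [invSet, Set.mem_ofPred_eq] at h ⊢
    tauto
  · rintro ⟨u, hu, rfl⟩
    have hr : cs.IsReflection u := by
      rcases hu with hu | hu <;> exact hu.1.1
    rw [Set.mem_symmDiff] at hu
    have := cs.isLeftInversion_inv_mul_iff (x := x) (y := y) hr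
    simp only [invSet, Set.mem_ofPred_eq] at hu ⊢
    tauto

theorem between_iff (x y z : W) :
    cs.length (x⁻¹ * z) = cs.length (x⁻¹ * y) + cs.length (y⁻¹ * z) ↔
      ∀ t, (cs.IsLeftInversion x t ↔ cs.IsLeftInversion z t) →
        (cs.IsLeftInversion y t ↔ cs.IsLeftInversion x t) := by
  have hf := fun w => cs.invSet_finite w
  have fin : ∀ a b, (symmDiff (cs.invSet a) (cs.invSet b)).Finite := fun a b =>
    ((hf a).union (hf b)).subset (Set.symmDiff_subset_union)
  rw [length_inv_mul_eq_ncard, length_inv_mul_eq_ncard, length_inv_mul_eq_ncard]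
  have h1 : symmDiff (cs.invSet x) (cs.invSet z) =
      (symmDiff (cs.invSet x) (cs.invSet y) ∪ symmDiff (cs.invSet y) (cs.invSet z)) \
      (symmDiff (cs.invSet x) (cs.invSet y) ∩ symmDiff (cs.invSet y) (cs.invSet z)) := by
    ext t; simp only [Set.mem_symmDiff, Set.mem_sdiff, Set.mem_union, Set.mem_inter_iff]; tauto
  set P := symmDiff (cs.invSet x) (cs.invSet y) with hP
  set Q := symmDiff (cs.invSet y) (cs.invSet z) with hQ
  have hfP : P.Finite := fin _ _
  have hfQ : Q.Finite := fin _ _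
  have h2 := Set.ncard_sdiff_add_ncard_of_subset
    (Set.inter_subset_left.trans Set.subset_union_left : P ∩ Q ⊆ P ∪ Q) (hfP.union hfQ)
  have h3 := Set.ncard_union_add_ncard_inter P Q hfP hfQ
  have h4 : (P ∩ Q).ncard = 0 ↔ P ∩ Q = ∅ := Set.ncard_eq_zero (hfP.inter_of_left _)
  have h5 : (symmDiff (cs.invSet x) (cs.invSet z)).ncard = P.ncard + Q.ncard ↔ P ∩ Q = ∅ := by
    rw [← h4, h1]; omega
  rw [h5, Set.eq_empty_iff_forall_notMem]
  refine forall_congr' fun t => ?_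
  simp only [hP, hQ, Set.mem_inter_iff, Set.mem_symmDiff, invSet, Set.mem_ofPred_eq]
  tauto

/-- The (weak) prefix order on `W`. -/
def Pre (v u : W) : Prop := cs.length u = cs.length v + cs.length (v⁻¹ * u)

theorem pre_iff {v u : W} :
    cs.Pre v u ↔ ∀ t, cs.IsLeftInversion v t → cs.IsLeftInversion u t := by
  have := cs.between_iff 1 v u
  simp only [inv_one, one_mul] at this
  rw [Pre, this]
  have h1 := cs.not_isLeftInversion_one
  refine forall_congr' fun t => ?_
  have := h1 t
  tauto

theorem invSet_injective : Function.Injective cs.invSet := by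
  intro x y h
  have := cs.length_inv_mul_eq_ncard x y
  rw [h, symmDiff_self] at this
  simp only [Set.bot_eq_empty, Set.ncard_empty, length_eq_zero_iff] at this
  exact (inv_mul_eq_one.1 this)

theorem finite_setOf_pre (u : W) : {v | cs.Pre v u}.Finite := by
  refine Set.Finite.of_finite_image (f := cs.invSet) ?_ cs.invSet_injective.injOn
  refine (cs.invSet_finite u).finite_subsets.subset ?_
  rintro _ ⟨v, hv, rfl⟩
  exact fun t ht => (cs.pre_iff.1 hv) t ht

theorem pre_refl (u : W) : cs.Pre u u := by simp [Pre]

theorem pre_trans {a b c : W} (h : cs.Pre a b) (h' : cs.Pre b c) : cs.Pre a c := by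
  rw [pre_iff] at *; exact fun t ht => h' t (h t ht)

theorem pre_of_between {e f g w : W} (he : cs.Pre e w) (hf : cs.Pre f w)
    (h : cs.length (e⁻¹ * f) = cs.length (e⁻¹ * g) + cs.length (g⁻¹ * f)) : cs.Pre g w := by
  rw [pre_iff] at *
  rw [between_iff] at h
  intro t ht
  have := h t
  have := he t
  have := hf t
  tauto

/-- If `g` lies in the interval from `1` to `w` and `e ≤ g`, then `e⁻¹ g ≤ e⁻¹ w`. -/
theorem pre_inv_mul {e g w : W} (h : cs.Pre e g) (h' : cs.Pre g w) :
    cs.Pre (e⁻¹ * g) (e⁻¹ * w) := by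
  have h3 := cs.pre_trans h h'
  simp only [Pre, mul_inv_rev, inv_inv] at *
  rw [show g⁻¹ * e * (e⁻¹ * w) = g⁻¹ * w by group]
  omega

theorem length_lt_of_isLeftInversion_both {s p q : W} (hp : cs.IsLeftInversion p s)
    (hq : cs.IsLeftInversion q s) : cs.length (p⁻¹ * q) < cs.length (p⁻¹ * s * q) := by
  have h := (cs.isLeftInversion_inv_mul_iff (x := p) (y := q) hp.1).not.2 (by tauto)
  have hr := cs.isReflection_conj_inv hp.1 p
  have h2 := (not_and.1 h) hr
  have h3 := hr.length_mul_right_ne (p⁻¹ * q)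
  rw [show p⁻¹ * s * p * (p⁻¹ * q) = p⁻¹ * s * q by group] at h2 h3
  omega

/-- The standard parabolic subgroup of type `I`. -/
abbrev par (I : Set B) : Subgroup W := Subgroup.closure (cs.simple '' I)

theorem simple_mem_par {I : Set B} {i : B} (hi : i ∈ I) : cs.simple i ∈ cs.par I :=
  Subgroup.subset_closure ⟨i, hi, rfl⟩

theorem exists_reduced_word_of_mem_par {I : Set B} {w : W} (hw : w ∈ cs.par I) :
    ∃ ω : List B, cs.IsReduced ω ∧ w = cs.wordProd ω ∧ ∀ i ∈ ω, i ∈ I := by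
  have step : ∀ i ∈ I, ∀ y, (∃ ω : List B, cs.IsReduced ω ∧ y = cs.wordProd ω ∧ ∀ i ∈ ω, i ∈ I) →
      (∃ ω : List B, cs.IsReduced ω ∧ cs.simple i * y = cs.wordProd ω ∧ ∀ i ∈ ω, i ∈ I) := by
    rintro i hi y ⟨ω, hω, rfl, hI⟩
    rcases cs.length_simple_mul (cs.wordProd ω) i with h | h
    · refine ⟨i :: ω, ?_, (cs.wordProd_cons i ω).symm, ?_⟩
      · rw [IsReduced, wordProd_cons, h, hω.eq, List.length_cons]
      · simpa using ⟨hi, hI⟩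
    · have hinv : cs.IsLeftInversion (cs.wordProd ω) (cs.simple i) :=
        ⟨cs.isReflection_simple i, by omega⟩
      obtain ⟨j, hj, hj'⟩ := List.getElem_of_mem (cs.mem_leftInvSeq_of_isLeftInversion hinv)
      have h2 := cs.getD_leftInvSeq_mul_wordProd ω j
      rw [List.getD_eq_getElem _ _ hj, hj'] at h2
      refine ⟨ω.eraseIdx j, ?_, h2, fun k hk => hI k (List.mem_of_mem_eraseIdx hk)⟩
      rw [IsReduced, ← h2]
      rw [length_leftInvSeq] at hj
      rw [List.length_eraseIdx_of_lt hj]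
      rw [hω.eq] at h
      omega
  induction hw using Subgroup.closure_induction_left with
  | one => exact ⟨[], by simp [IsReduced], by simp, by simp⟩
  | mul_left x hx y hy ih =>
    obtain ⟨i, hi, rfl⟩ := hx
    exact step i hi y ih
  | inv_mul_cancel x hx y hy ih =>
    obtain ⟨i, hi, rfl⟩ := hx
    rw [inv_simple]
    exact step i hi y ih

theorem exists_descent_of_mem_par {I : Set B} {w : W} (hw : w ∈ cs.par I) (h1 : w ≠ 1) :
    ∃ i ∈ I, cs.IsLeftInversion w (cs.simple i) := by
  obtain ⟨ω, hω, rfl, hI⟩ := cs.exists_reduced_word_of_mem_par hw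
  cases ω with
  | nil => simp at h1
  | cons i ω =>
    refine ⟨i, hI i (by simp), cs.isReflection_simple i, ?_⟩
    rw [hω.eq, wordProd_cons, simple_mul_simple_cancel_left]
    have := cs.length_wordProd_le ω
    simp only [List.length_cons]; omega

theorem isLeftInversion_simple_iff {w : W} {i : B} :
    cs.IsLeftInversion w (cs.simple i) ↔ cs.length (cs.simple i * w) + 1 = cs.length w := by
  rw [isLeftInversion_simple_iff_isLeftDescent, isLeftDescent_iff]

theorem not_isLeftInversion_simple_iff {w : W} {i : B} :
    ¬ cs.IsLeftInversion w (cs.simple i) ↔ cs.length (cs.simple i * w) = cs.length w + 1 := by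
  rw [isLeftInversion_simple_iff_isLeftDescent, not_isLeftDescent_iff]

/-- `w` has no left descent in `I`. -/
def LRed (I : Set B) (w : W) : Prop := ∀ i ∈ I, ¬ cs.IsLeftInversion w (cs.simple i)

/-- Induction along reduced words of a standard parabolic subgroup. -/
theorem par_induction {I : Set B} {p : W → Prop} (h1 : p 1)
    (hs : ∀ i ∈ I, ∀ v ∈ cs.par I, cs.length (cs.simple i * v) = cs.length v + 1 → p v →
      p (cs.simple i * v)) {w : W} (hw : w ∈ cs.par I) : p w := by
  generalize hn : cs.length w = n
  induction n generalizing w with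
  | zero => rw [length_eq_zero_iff] at hn; rwa [hn]
  | succ n ih =>
    have hne : w ≠ 1 := by rintro rfl; simp at hn
    obtain ⟨i, hi, hw'⟩ := cs.exists_descent_of_mem_par hw hne
    rw [isLeftInversion_simple_iff] at hw'
    have hv := mul_mem (cs.simple_mem_par hi) hw
    have := hs i hi _ hv (by rw [simple_mul_simple_cancel_left]; omega)
      (ih hv (by omega))
    rwa [simple_mul_simple_cancel_left] at this

theorem length_mul_of_minimal {I : Set B} {w q : W}
    (hmin : ∀ p ∈ cs.par I, cs.length w ≤ cs.length (p * w)) (hq : q ∈ cs.par I) :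
    cs.length (q * w) = cs.length q + cs.length w := by
  refine cs.par_induction (p := fun q => cs.length (q * w) = cs.length q + cs.length w)
    (by simp) ?_ hq
  intro i hi v hv hl ih
  have hr := cs.isReflection_simple i
  have h1 : ¬ cs.IsLeftInversion v (cs.simple i) := by
    rw [not_isLeftInversion_simple_iff]; exact hl
  have h2 : ¬ cs.IsLeftInversion w (v⁻¹ * cs.simple i * v) := fun h => by
    have := hmin _ (mul_mem (mul_mem (inv_mem hv) (cs.simple_mem_par hi)) hv)
    have := h.2
    omega
  have h3 : ¬ cs.IsLeftInversion (v * w) (cs.simple i) := by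
    rw [isLeftInversion_mul_iff _ hr]; tauto
  rw [not_isLeftInversion_simple_iff] at h3
  rw [mul_assoc, h3, ih, hl]; omega

theorem LRed.length_mul {I : Set B} {w q : W} (hw : cs.LRed I w) (hq : q ∈ cs.par I) :
    cs.length (q * w) = cs.length q + cs.length w := by
  obtain ⟨p, hp, hmin⟩ : ∃ p ∈ cs.par I, ∀ r ∈ cs.par I,
      cs.length (p * w) ≤ cs.length (r * w) := by
    have := (wellFounded_lt (α := ℕ)).has_min ((fun p => cs.length (p * w)) '' (cs.par I : Set W))
      ⟨_, 1, one_mem _, rfl⟩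
    obtain ⟨_, ⟨p, hp, rfl⟩, h⟩ := this
    exact ⟨p, hp, fun r hr => not_lt.1 (h _ ⟨r, hr, rfl⟩)⟩
  have hmin' : ∀ r ∈ cs.par I, cs.length (p * w) ≤ cs.length (r * (p * w)) := fun r hr => by
    rw [← mul_assoc]; exact hmin _ (mul_mem hr hp)
  have h1 : p = 1 := by
    by_contra hne
    obtain ⟨i, hi, h⟩ := cs.exists_descent_of_mem_par (inv_mem hp) (inv_ne_one.2 hne)
    apply hw i hi
    have h2 := cs.length_mul_of_minimal hmin' (inv_mem hp)
    rw [inv_mul_cancel_left] at h2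
    refine ⟨cs.isReflection_simple i, ?_⟩
    have h3 := cs.length_mul_le (cs.simple i * p⁻¹) (p * w)
    rw [mul_assoc, inv_mul_cancel_left] at h3
    have := h.2
    omega
  subst h1
  simp only [one_mul] at hmin'
  exact cs.length_mul_of_minimal hmin' hq

theorem LRed.length_mul_right {I : Set B} {w q : W} (hw : cs.LRed I w⁻¹) (hq : q ∈ cs.par I) :
    cs.length (w * q) = cs.length w + cs.length q := by
  have := LRed.length_mul cs hw (inv_mem hq)
  rw [← mul_inv_rev, length_inv, length_inv, length_inv] at this
  omega

theorem isLeftInversion_simple_right {i : B} {t : W} (h : cs.IsLeftInversion (cs.simple i) t) :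
    t = cs.simple i := by
  have := cs.mem_leftInvSeq_of_isLeftInversion (ω := [i]) (by simpa using h)
  simpa using this

/-- Deodhar's lemma. -/
theorem LRed.mul_simple {I : Set B} {w : W} (hw : cs.LRed I w) (j : B) :
    cs.LRed I (w * cs.simple j) ∨ ∃ i ∈ I, w * cs.simple j = cs.simple i * w := by
  by_cases h : cs.LRed I (w * cs.simple j)
  · exact Or.inl h
  · right
    simp only [LRed, not_forall, not_not] at h
    obtain ⟨i, hi, h⟩ := h
    rw [isLeftInversion_mul_iff _ (cs.isReflection_simple i)] at h
    have h2 := cs.isLeftInversion_simple_right (not_not.1 fun h' => hw i hi (h.2 h'))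
    refine ⟨i, hi, ?_⟩
    rw [← h2]; group

theorem pre_of_descents {L : Set B} {u v : W}
    (hu : ∀ l ∈ L, cs.IsLeftInversion u (cs.simple l)) (hv : v ∈ cs.par L) : cs.Pre v u := by
  refine cs.par_induction (p := fun v => cs.Pre v u) (by simp [Pre]) ?_ hv
  clear hv v
  intro i hi v hv hl ih
  have hr := cs.isReflection_simple i
  have h1 : ¬ cs.IsLeftInversion v (cs.simple i) := by
    rw [not_isLeftInversion_simple_iff]; exact hl
  have h2 := (cs.isLeftInversion_inv_mul_iff (x := v) (y := u) hr).2 (by have := hu i hi; tauto)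
  have h3 := h2.2
  rw [show v⁻¹ * cs.simple i * v * (v⁻¹ * u) = v⁻¹ * cs.simple i * u by group] at h3
  rw [Pre] at ih ⊢
  rw [mul_inv_rev, inv_simple]
  have h4 := cs.length_mul_le (cs.simple i * v) (v⁻¹ * cs.simple i * u)
  rw [show cs.simple i * v * (v⁻¹ * cs.simple i * u) = u by simp [mul_assoc]] at h4
  omega

theorem sphType_of_descents {L : Set B} {u : W}
    (hu : ∀ l ∈ L, cs.IsLeftInversion u (cs.simple l)) : SphType cs L :=
  (cs.finite_setOf_pre u).subset fun _ hv => cs.pre_of_descents hu hv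

theorem exists_longest {J : Set B} (hJ : SphType cs J) :
    ∃ u ∈ cs.par J, ∀ v ∈ cs.par J, cs.Pre v u := by
  obtain ⟨u, hu, hmax⟩ := Set.exists_max_image _ cs.length hJ ⟨1, one_mem _⟩
  refine ⟨u, hu, fun v hv => cs.pre_of_descents (fun l hl => ?_) hv⟩
  by_contra h
  rw [not_isLeftInversion_simple_iff] at h
  have := hmax _ (mul_mem (cs.simple_mem_par hl) hu)
  omega

theorem par_mono {I J : Set B} (h : I ⊆ J) : cs.par I ≤ cs.par J :=
  Subgroup.closure_mono (Set.image_mono h)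

end CoxeterSystem

namespace Bldg

variable {cs : CoxeterSystem M W} (X : Bldg cs)

theorem delta_self (C : X.Chamber) : X.delta C C = 1 := (X.delta_eq_one_iff C C).2 rfl

theorem gdist_self (C : X.Chamber) : X.gdist C C = 0 := by simp [gdist, delta_self]

theorem eq_of_gdist_eq_zero {C D : X.Chamber} (h : X.gdist C D = 0) : C = D :=
  (X.delta_eq_one_iff C D).1 (cs.length_eq_zero_iff.1 h)

theorem delta_simple_symm {C D : X.Chamber} {i : B} (h : X.delta C D = cs.simple i) :
    X.delta D C = cs.simple i := by
  obtain ⟨E, h1, h2⟩ := X.exists_delta C D i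
  rw [h, cs.simple_mul_simple_self, X.delta_eq_one_iff] at h2
  rwa [h2]

theorem delta_eq_mul_of_length {C D E : X.Chamber}
    (h : cs.length (X.delta C D * X.delta D E) = cs.length (X.delta C D) + X.gdist D E) :
    X.delta C E = X.delta C D * X.delta D E := by
  generalize hn : X.gdist D E = n at h
  induction n generalizing E with
  | zero =>
    obtain rfl := X.eq_of_gdist_eq_zero hn
    simp [delta_self]
  | succ n ih =>
    have hne : X.delta D E ≠ 1 := by
      intro h1; rw [gdist, h1] at hn; simp at hn
    obtain ⟨i, hi⟩ := cs.exists_rightDescent_of_ne_one hne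
    rw [cs.isRightDescent_iff] at hi
    obtain ⟨E', h1, h2⟩ := X.exists_delta D E i
    rw [gdist] at hn
    have h3 : cs.length (X.delta C D * X.delta D E') = cs.length (X.delta C D) + n := by
      rw [h2, ← mul_assoc]
      have h4 := cs.length_mul_le (X.delta C D) (X.delta D E * cs.simple i)
      have h5 := cs.length_mul_simple (X.delta C D * X.delta D E) i
      rw [← mul_assoc] at h4
      omega
    have h6 := ih (E := E') (by rw [gdist, h2]; omega) h3
    have h7 := X.delta_eq_of_length C E' E i (X.delta_simple_symm h1) (by
      rw [h6, h2]; simp only [mul_assoc, cs.simple_mul_simple_self, mul_one]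
      rw [h, ← mul_assoc, mul_assoc, ← h2, h3]; rfl)
    rw [h7, h6, h2]; simp [mul_assoc]

theorem delta_symm (C D : X.Chamber) : X.delta D C = (X.delta C D)⁻¹ := by
  generalize hn : X.gdist C D = n
  induction n generalizing D with
  | zero =>
    obtain rfl := X.eq_of_gdist_eq_zero hn
    simp [delta_self]
  | succ n ih =>
    have hne : X.delta C D ≠ 1 := by
      intro h1; rw [gdist, h1] at hn; simp at hn
    obtain ⟨i, hi⟩ := cs.exists_rightDescent_of_ne_one hne
    rw [cs.isRightDescent_iff] at hi
    obtain ⟨E, h1, h2⟩ := X.exists_delta C D i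
    rw [gdist] at hn
    have h3 := ih E (by rw [gdist, h2]; omega)
    have h4 := X.delta_eq_mul_of_length (C := D) (D := E) (E := C) (by
      rw [gdist, h3, h1, h2, ← cs.inv_simple i, ← mul_inv_rev, mul_assoc]
      simp only [cs.inv_simple, cs.simple_mul_simple_self, mul_one, cs.length_inv,
        cs.length_simple]
      omega)
    rw [h4, h3, h1, h2]; simp

theorem gdist_symm (C D : X.Chamber) : X.gdist D C = X.gdist C D := by
  rw [gdist, delta_symm, cs.length_inv, gdist]

theorem exists_delta_left (C D : X.Chamber) (i : B) :
    ∃ E, X.delta C E = cs.simple i ∧ X.delta E D = cs.simple i * X.delta C D := by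
  obtain ⟨E, h1, h2⟩ := X.exists_delta D C i
  refine ⟨E, h1, ?_⟩
  rw [X.delta_symm D E, h2, X.delta_symm C D]; simp

/-- Induction on the Weyl distance along galleries starting at the first chamber. -/
theorem gallery_induction {I : Set B} {p : X.Chamber → X.Chamber → Prop}
    (h1 : ∀ C, p C C)
    (hs : ∀ C D E, ∀ i ∈ I, X.delta C D = cs.simple i → X.delta D E ∈ cs.par I →
      X.gdist C E = X.gdist D E + 1 → p D E → p C E)
    {C E : X.Chamber} (h : X.delta C E ∈ cs.par I) : p C E := by
  generalize hn : X.gdist C E = n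
  induction n generalizing C with
  | zero =>
    obtain rfl := X.eq_of_gdist_eq_zero hn
    exact h1 C
  | succ n ih =>
    have hne : X.delta C E ≠ 1 := by
      intro h1; rw [gdist, h1] at hn; simp at hn
    obtain ⟨i, hi, hi'⟩ := cs.exists_descent_of_mem_par h hne
    rw [cs.isLeftInversion_simple_iff] at hi'
    obtain ⟨D, hD, hD'⟩ := X.exists_delta_left C E i
    have hl : X.gdist D E = n := by
      rw [gdist, hD']; rw [gdist] at hn; omega
    have hm : X.delta D E ∈ cs.par I := by
      rw [hD']; exact mul_mem (cs.simple_mem_par hi) h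
    exact hs C D E i hi hD hm (by omega) (ih hm hl)

theorem par_univ : cs.par (Set.univ : Set B) = ⊤ := by
  rw [CoxeterSystem.par, Set.image_univ, cs.subgroup_closure_range_simple]

theorem delta_inv_mul_mem_par {I : Set B} {C D E : X.Chamber} (h : X.delta D E ∈ cs.par I) :
    (X.delta C D)⁻¹ * X.delta C E ∈ cs.par I := by
  refine X.gallery_induction (I := I)
    (p := fun D E => (X.delta C D)⁻¹ * X.delta C E ∈ cs.par I) ?_ ?_ h
  · intro D; simp
  · intro D D' E i hi hD hm _ ih
    have h2 : (X.delta C D)⁻¹ * X.delta C D' ∈ cs.par I := by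
      rcases X.delta_mem_pair C D D' i hD with h | h
      · rw [h]; simpa using cs.simple_mem_par hi
      · rw [h]; simp
    have := mul_mem h2 ih
    simpa [mul_assoc] using this

theorem gdist_triangle (C D E : X.Chamber) : X.gdist C E ≤ X.gdist C D + X.gdist D E := by
  have hm : X.delta D E ∈ cs.par (Set.univ : Set B) := by rw [par_univ]; trivial
  refine X.gallery_induction (I := Set.univ)
    (p := fun D E => X.gdist C E ≤ X.gdist C D + X.gdist D E) ?_ ?_ hm
  · intro D; simp
  · intro D D' E i hi hD hm hl ih
    have h2 : X.gdist C D' ≤ X.gdist C D + 1 := by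
      simp only [gdist]
      rcases X.delta_mem_pair C D D' i hD with h | h
      · rw [h]
        rcases cs.length_mul_simple (X.delta C D) i with h | h <;> omega
      · rw [h]; omega
    omega

theorem delta_eq_mul_of_between {C D E : X.Chamber}
    (h : X.gdist C E = X.gdist C D + X.gdist D E) :
    X.delta C E = X.delta C D * X.delta D E := by
  have hm : X.delta D E ∈ cs.par (Set.univ : Set B) := by rw [par_univ]; trivial
  revert h
  refine X.gallery_induction (I := Set.univ)
    (p := fun D E => X.gdist C E = X.gdist C D + X.gdist D E →
      X.delta C E = X.delta C D * X.delta D E) ?_ ?_ hm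
  · intro D _; simp [delta_self]
  · intro D D' E i hi hD hm hl ih h
    have h3 := X.gdist_triangle C D' E
    have h4 : X.delta C D' = X.delta C D * cs.simple i := by
      rcases X.delta_mem_pair C D D' i hD with h | h
      · exact h
      · have : X.gdist C D' = X.gdist C D := by rw [gdist, h, gdist]
        omega
    have h5 : X.gdist C D' ≤ X.gdist C D + 1 := by
      rw [gdist, h4]
      have := cs.length_mul_le (X.delta C D) (cs.simple i)
      rwa [cs.length_simple] at this
    rw [ih (by omega), h4]
    have h6 := X.delta_eq_mul_of_length (C := D) (D := D') (E := E) (by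
      rw [hD, cs.length_simple]
      have h7 := cs.length_mul_le (cs.simple i) (X.delta D' E)
      have h8 := X.gdist_triangle D D' E
      have h9 : X.gdist D D' = 1 := by rw [gdist, hD, cs.length_simple]
      have ha := X.gdist_triangle C D E
      rw [cs.length_simple] at h7
      rcases cs.length_simple_mul (X.delta D' E) i with hb | hb
      · rw [hb, gdist]; omega
      · exfalso
        obtain ⟨F, hF, hF'⟩ := X.exists_delta_left D' E i
        have hc : X.gdist F E + 1 = X.gdist D' E := by rw [gdist, hF', gdist, hb]
        have hd := X.delta_mem_pair D D' F i hF
        rw [hD, cs.simple_mul_simple_self] at hd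
        rcases hd with hd | hd
        · rw [X.delta_eq_one_iff] at hd; subst hd; omega
        · have he := X.gdist_triangle D F E
          have hf : X.gdist D F = 1 := by rw [gdist, hd, cs.length_simple]
          omega)
    rw [h6, hD]; simp [mul_assoc]

theorem gdist_retraction_le (C D E : X.Chamber) :
    cs.length ((X.delta C D)⁻¹ * X.delta C E) ≤ X.gdist D E := by
  have hm : X.delta D E ∈ cs.par (Set.univ : Set B) := by rw [par_univ]; trivial
  refine X.gallery_induction (I := Set.univ)
    (p := fun D E => cs.length ((X.delta C D)⁻¹ * X.delta C E) ≤ X.gdist D E) ?_ ?_ hm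
  · intro D; simp
  · intro D D' E i hi hD hm hl ih
    have h2 : cs.length ((X.delta C D)⁻¹ * X.delta C D') ≤ 1 := by
      rcases X.delta_mem_pair C D D' i hD with h | h
      · rw [h]; simp
      · rw [h]; simp
    have h3 := cs.length_mul_le ((X.delta C D)⁻¹ * X.delta C D')
      ((X.delta C D')⁻¹ * X.delta C E)
    rw [mul_assoc, mul_inv_cancel_left] at h3
    omega

theorem between_iff_length {C D E : X.Chamber} :
    X.gdist C E = X.gdist C D + X.gdist D E ↔ X.delta C E = X.delta C D * X.delta D E ∧
      cs.length (X.delta C D * X.delta D E) = X.gdist C D + X.gdist D E :=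
  ⟨fun h => by have := X.delta_eq_mul_of_between h; exact ⟨this, by rw [← this]; exact h⟩,
    fun h => by rw [← h.2, ← h.1]; rfl⟩

theorem mem_residue {I : Set B} {C D : X.Chamber} :
    D ∈ X.residue I C ↔ X.delta C D ∈ cs.par I := Iff.rfl

theorem self_mem_residue (I : Set B) (C : X.Chamber) : C ∈ X.residue I C := by
  rw [mem_residue, delta_self]; exact one_mem _

theorem residue_eq_of_mem {I : Set B} {C D : X.Chamber} (h : D ∈ X.residue I C) :
    X.residue I D = X.residue I C := by
  ext E
  rw [mem_residue] at *
  rw [mem_residue]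
  constructor
  · intro h2
    have := mul_mem h (X.delta_inv_mul_mem_par (C := C) h2)
    simpa using this
  · intro h2
    have h3 : X.delta D C ∈ cs.par I := by rw [delta_symm]; exact inv_mem h
    have := mul_mem h3 (X.delta_inv_mul_mem_par (C := D) h2)
    simpa using this

theorem delta_mem_of_mem_residue {I : Set B} {A C D : X.Chamber} (hC : C ∈ X.residue I A)
    (hD : D ∈ X.residue I A) : X.delta C D ∈ cs.par I := by
  rw [← X.residue_eq_of_mem hC] at hD
  exact hD

theorem mem_residue_of_delta_mem {I : Set B} {A C D : X.Chamber} (hC : C ∈ X.residue I A)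
    (hD : X.delta C D ∈ cs.par I) : D ∈ X.residue I A := by
  rw [← X.residue_eq_of_mem hC]
  exact hD

/-- `R` is a residue of some type (not necessarily spherical). -/
def IsRes (R : Set X.Chamber) : Prop := ∃ (I : Set B) (C : X.Chamber), R = X.residue I C

theorem isRes_residue (I : Set B) (C : X.Chamber) : X.IsRes (X.residue I C) := ⟨I, C, rfl⟩

variable {X} in
theorem IsSphResidue.isRes {R : Set X.Chamber} (h : X.IsSphResidue R) : X.IsRes R := by
  obtain ⟨I, C, -, h⟩ := h; exact ⟨I, C, h⟩

theorem between_of_lRed {I : Set B} {C D E : X.Chamber} (h : cs.LRed I (X.delta D C))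
    (hE : X.delta D E ∈ cs.par I) : X.gdist C E = X.gdist C D + X.gdist D E := by
  rw [delta_symm] at h
  have h1 := CoxeterSystem.LRed.length_mul_right cs h hE
  rw [between_iff_length]
  exact ⟨X.delta_eq_mul_of_length h1, h1⟩

theorem exists_gate {R : Set X.Chamber} (hR : X.IsRes R) (C : X.Chamber) :
    ∃ D ∈ R, ∀ E ∈ R, X.gdist C E = X.gdist C D + X.gdist D E := by
  obtain ⟨I, A, rfl⟩ := hR
  have := (wellFounded_lt (α := ℕ)).has_min (X.gdist C '' X.residue I A)
      ⟨_, A, X.self_mem_residue I A, rfl⟩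
  obtain ⟨_, ⟨D, hD, rfl⟩, hmin⟩ := this
  refine ⟨D, hD, fun E hE => X.between_of_lRed ?_ (X.delta_mem_of_mem_residue hD hE)⟩
  intro i hi h
  rw [cs.isLeftInversion_simple_iff] at h
  obtain ⟨F, hF, hF'⟩ := X.exists_delta_left D C i
  refine hmin (X.gdist C F) ⟨F, X.mem_residue_of_delta_mem hD ?_, rfl⟩ ?_
  · rw [hF]; exact cs.simple_mem_par hi
  · rw [X.gdist_symm F C, X.gdist_symm D C, gdist, hF', gdist]; omega

section

variable {X} {R : Set X.Chamber}

theorem gate_mem (hR : X.IsRes R) (C : X.Chamber) : X.gate R C ∈ R :=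
  (Classical.epsilon_spec (X.exists_gate hR C)).1

theorem gate_between (hR : X.IsRes R) {C E : X.Chamber} (hE : E ∈ R) :
    X.gdist C E = X.gdist C (X.gate R C) + X.gdist (X.gate R C) E :=
  (Classical.epsilon_spec (X.exists_gate hR C)).2 E hE

theorem eq_gate (hR : X.IsRes R) {C D : X.Chamber} (hD : D ∈ R)
    (h : X.gdist C (X.gate R C) = X.gdist C D + X.gdist D (X.gate R C)) : X.gate R C = D := by
  have h1 := gate_between hR hD (C := C)
  exact X.eq_of_gdist_eq_zero (by omega)

theorem gate_of_mem (hR : X.IsRes R) {C : X.Chamber} (hC : C ∈ R) : X.gate R C = C :=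
  eq_gate hR hC (by simp [gdist_self])

end

theorem lRed_of_gate {I : Set B} {A C D : X.Chamber} (hD : D ∈ X.residue I A)
    (h : X.gate (X.residue I A) C = D) : cs.LRed I (X.delta D C) := by
  intro i hi hl
  rw [cs.isLeftInversion_simple_iff] at hl
  obtain ⟨F, hF, hF'⟩ := X.exists_delta_left D C i
  have h1 := gate_between (X.isRes_residue I A) (C := C)
    (X.mem_residue_of_delta_mem hD (by rw [hF]; exact cs.simple_mem_par hi))
  rw [h, X.gdist_symm F C, X.gdist_symm D C, gdist, hF'] at h1
  simp only [gdist] at h1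
  omega

theorem gate_of_lRed {I : Set B} {A C D : X.Chamber} (hD : D ∈ X.residue I A)
    (h : cs.LRed I (X.delta D C)) : X.gate (X.residue I A) C = D :=
  eq_gate (X.isRes_residue I A) hD (X.between_of_lRed h
    (X.delta_mem_of_mem_residue hD (gate_mem (X.isRes_residue I A) C)))

end Bldg

theorem CoxeterSystem.eq_of_lRed_inv (cs : CoxeterSystem M W) {J : Set B} {x y : W}
    (hx : cs.LRed J x⁻¹) (hy : cs.LRed J y⁻¹) (h : x⁻¹ * y ∈ cs.par J) : x = y := by
  have h1 := CoxeterSystem.LRed.length_mul_right cs hx h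
  have h2 := CoxeterSystem.LRed.length_mul_right cs hy (inv_mem h)
  rw [mul_inv_cancel_left] at h1
  rw [mul_inv_rev, inv_inv, mul_inv_cancel_left] at h2
  have h3 : cs.length (x⁻¹ * y) = 0 := by omega
  rw [cs.length_eq_zero_iff] at h3
  exact inv_mul_eq_one.1 h3

namespace Bldg

variable {cs : CoxeterSystem M W} {X : Bldg cs}

theorem gate_gate {ρ σ : Set X.Chamber} (hρ : X.IsRes ρ) (hσ : X.IsRes σ) (h : ρ ⊆ σ)
    (D : X.Chamber) : X.gate ρ (X.gate σ D) = X.gate ρ D := by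
  have m1 := gate_mem hρ (X.gate σ D)
  have m2 := gate_mem hρ D
  have h1 := gate_between hσ (h m1) (C := D)
  have h2 := gate_between hρ m1 (C := D)
  have h3 := gate_between hσ (h m2) (C := D)
  have h4 := gate_between hρ m2 (C := X.gate σ D)
  refine (eq_gate hρ m1 ?_).symm
  omega

theorem gate_of_between {σ : Set X.Chamber} (hσ : X.IsRes σ) {D E : X.Chamber}
    (h : X.gdist D (X.gate σ D) = X.gdist D E + X.gdist E (X.gate σ D)) :
    X.gate σ E = X.gate σ D := by
  have h1 := gate_between hσ (gate_mem hσ D) (C := E)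
  have h2 := gate_between hσ (gate_mem hσ E) (C := D)
  have h3 := X.gdist_triangle D E (X.gate σ E)
  exact X.eq_of_gdist_eq_zero (by omega)

theorem gate_gate_of_mem_projSet {σ R : Set X.Chamber} (hσ : X.IsRes σ) (hR : X.IsRes R)
    {c : X.Chamber} (hc : c ∈ X.projSet σ R) : X.gate σ (X.gate R c) = c := by
  obtain ⟨D, hD, rfl⟩ := hc
  apply gate_of_between hσ
  have := gate_between hR hD (C := X.gate σ D)
  rw [X.gdist_symm, this, X.gdist_symm D, X.gdist_symm (X.gate σ D), add_comm]

theorem projSet_eq_residue {I J : Set B} {A A' C₀ : X.Chamber} (hC₀ : C₀ ∈ X.residue J A') :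
    ∃ K ⊆ I, X.projSet (X.residue I A) (X.residue J A') =
      X.residue K (X.gate (X.residue I A) C₀) := by
  have hσ := X.isRes_residue I A
  have hR := X.isRes_residue J A'
  set σ := X.residue I A with hσ'
  set R := X.residue J A' with hR'
  set D₀ := X.gate σ C₀ with hD₀
  have hD₀σ : D₀ ∈ σ := gate_mem hσ _
  set C := X.gate R D₀ with hC
  have hCR : C ∈ R := gate_mem hR _
  have hgC : X.gate σ C = D₀ := gate_gate_of_mem_projSet hσ hR ⟨C₀, hC₀, rfl⟩
  set w := X.delta D₀ C with hw
  have hwI : cs.LRed I w := X.lRed_of_gate hD₀σ hgC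
  have hwJ : cs.LRed J w⁻¹ := by
    rw [hw, ← delta_symm]; exact X.lRed_of_gate hCR rfl
  let K : Set B := {i | i ∈ I ∧ w⁻¹ * cs.simple i * w ∈ cs.par J}
  have hK : ∀ q ∈ cs.par K, w⁻¹ * q * w ∈ cs.par J := by
    intro q hq
    have : cs.par K ≤ (cs.par J).comap (MulAut.conj w⁻¹).toMonoidHom := by
      rw [CoxeterSystem.par, Subgroup.closure_le]
      rintro _ ⟨i, hi, rfl⟩
      simpa using hi.2
    simpa using this hq
  have hKI : K ⊆ I := fun i hi => hi.1
  have hKσ : ∀ D' ∈ X.residue K D₀, D' ∈ σ := fun D' hD' =>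
    X.mem_residue_of_delta_mem hD₀σ (cs.par_mono hKI hD')
  have key : ∀ D' ∈ X.residue K D₀, X.delta D' (X.gate R D') = w := by
    intro D' hD'
    have h0 : X.delta D' D₀ ∈ cs.par K := by rw [delta_symm]; exact inv_mem hD'
    have h1 : X.delta D' C = X.delta D' D₀ * w :=
      X.delta_eq_mul_of_length (by
        rw [CoxeterSystem.LRed.length_mul cs hwI (cs.par_mono hKI h0)]; rfl)
    have h2 := X.delta_eq_mul_of_between (gate_between hR hCR (C := D'))
    have h3 : X.delta (X.gate R D') C ∈ cs.par J :=
      X.delta_mem_of_mem_residue (gate_mem hR _) hCR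
    have h4 : cs.LRed J (X.delta D' (X.gate R D'))⁻¹ := by
      rw [← delta_symm]; exact X.lRed_of_gate (gate_mem hR _) rfl
    refine cs.eq_of_lRed_inv h4 hwJ ?_
    have h5 : (X.delta D' (X.gate R D'))⁻¹ * w =
        X.delta (X.gate R D') C * (w⁻¹ * X.delta D' D₀ * w)⁻¹ := by
      rw [h1] at h2
      rw [← inv_mul_eq_iff_eq_mul] at h2
      rw [← h2]; group
    rw [h5]
    exact mul_mem h3 (inv_mem (hK _ h0))
  refine ⟨K, hKI, Set.Subset.antisymm ?_ ?_⟩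
  · rintro _ ⟨C', hC', rfl⟩
    have main : ∀ C₁ C₂, X.delta C₁ C₂ ∈ cs.par J → C₁ ∈ R → X.gate σ C₁ ∈ X.residue K D₀ →
        X.gate σ C₂ ∈ X.residue K D₀ := by
      intro C₁ C₂ h
      refine X.gallery_induction (I := J) (p := fun C₁ C₂ => C₁ ∈ R →
        X.gate σ C₁ ∈ X.residue K D₀ → X.gate σ C₂ ∈ X.residue K D₀) (by simp) ?_ h
      intro C₁ C₂ C₃ j hj hd _ _ ih hC₁ hD₁
      have hC₂ : C₂ ∈ R := X.mem_residue_of_delta_mem hC₁ (by rw [hd]; exact cs.simple_mem_par hj)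
      refine ih hC₂ ?_
      set D₁ := X.gate σ C₁ with hD₁'
      have hD₁σ : D₁ ∈ σ := hKσ _ hD₁
      have hy : cs.LRed I (X.delta D₁ C₁) := X.lRed_of_gate hD₁σ rfl
      have hred : cs.LRed I (X.delta D₁ C₂) → X.gate σ C₂ ∈ X.residue K D₀ := fun h => by
        rw [X.gate_of_lRed hD₁σ h]; exact hD₁
      rcases X.delta_mem_pair D₁ C₁ C₂ j hd with h | h
      · rcases CoxeterSystem.LRed.mul_simple cs hy j with h' | ⟨i, hi, h'⟩
        · exact hred (h ▸ h')
        · obtain ⟨D₂, h1, h2⟩ := X.exists_delta_left D₁ C₂ i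
          rw [h, h', cs.simple_mul_simple_cancel_left] at h2
          have hD₂σ : D₂ ∈ σ :=
            X.mem_residue_of_delta_mem hD₁σ (by rw [h1]; exact cs.simple_mem_par hi)
          rw [X.gate_of_lRed hD₂σ (h2 ▸ hy)]
          refine X.mem_residue_of_delta_mem hD₁ ?_
          rw [h1]
          refine cs.simple_mem_par ⟨hi, ?_⟩
          have h3 := X.delta_eq_mul_of_between (gate_between hR hC₁ (C := D₁))
          rw [key D₁ hD₁] at h3
          have h4 : X.delta (X.gate R D₁) C₁ ∈ cs.par J :=
            X.delta_mem_of_mem_residue (gate_mem hR _) hC₁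
          have h5 : w⁻¹ * cs.simple i * w =
              X.delta (X.gate R D₁) C₁ * cs.simple j * (X.delta (X.gate R D₁) C₁)⁻¹ := by
            rw [h3] at h'
            have h6 : cs.simple j = (w * X.delta (X.gate R D₁) C₁)⁻¹ *
                (cs.simple i * (w * X.delta (X.gate R D₁) C₁)) := by
              rw [← h']; group
            rw [h6]; group
          rw [h5]
          exact mul_mem (mul_mem h4 (cs.simple_mem_par hj)) (inv_mem h4)
      · exact hred (h ▸ hy)
    exact main C₀ C' (X.delta_mem_of_mem_residue hC₀ hC') hC₀ (X.self_mem_residue K D₀)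
  · intro D' hD'
    exact ⟨X.gate R D', gate_mem hR _, X.gate_of_lRed (hKσ _ hD') (by rw [key D' hD']; exact hwI)⟩

theorem _root_.SphType.mono {I K : Set B} (hI : SphType cs I) (h : K ⊆ I) : SphType cs K :=
  Set.Finite.subset hI (cs.par_mono h)

theorem isSphResidue_projSet {σ R : Set X.Chamber} (hσ : X.IsSphResidue σ) (hR : X.IsRes R) :
    X.IsSphResidue (X.projSet σ R) := by
  obtain ⟨I, A, hI, rfl⟩ := hσ
  obtain ⟨J, A', rfl⟩ := hR
  obtain ⟨K, hK, h⟩ := projSet_eq_residue (I := I) (A := A) (X.self_mem_residue J A')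
  exact ⟨K, _, hI.mono hK, h⟩

theorem Res.isRes (R : X.Res) : X.IsRes R.1 := R.2.isRes

theorem projRes_val (σ R : X.Res) : (X.projRes σ R).1 = X.projSet σ.1 R.1 :=
  Classical.epsilon_spec (p := fun U : X.Res => U.1 = X.projSet σ.1 R.1)
    ⟨⟨_, isSphResidue_projSet σ.2 R.isRes⟩, rfl⟩

theorem Res.nonempty (R : X.Res) : R.1.Nonempty := by
  obtain ⟨I, A, -, h⟩ := R.2
  exact ⟨A, h ▸ X.self_mem_residue I A⟩

theorem projRes_subset (σ R : X.Res) : (X.projRes σ R).1 ⊆ σ.1 := by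
  rw [projRes_val]
  rintro _ ⟨D, -, rfl⟩
  exact gate_mem σ.isRes D

theorem mem_projRes {σ R : X.Res} {c : X.Chamber} :
    c ∈ (X.projRes σ R).1 ↔ ∃ D ∈ R.1, X.gate σ.1 D = c := by
  rw [projRes_val]; rfl

theorem Res.ext' {R T : X.Res} (h : R.1 = T.1) : R = T := Subtype.ext h

theorem projRes_projRes_of_subset {ρ σ R : X.Res} (h : ρ.1 ⊆ σ.1) :
    X.projRes ρ (X.projRes σ R) = X.projRes ρ R := by
  apply Res.ext'
  rw [projRes_val, projRes_val, projRes_val, projSet, projSet, projSet, Set.image_image]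
  exact Set.image_congr fun D _ => gate_gate ρ.isRes σ.isRes h D

theorem projRes_self_of_subset {σ R : X.Res} (h : R.1 ⊆ σ.1) : X.projRes σ R = R := by
  apply Res.ext'
  rw [projRes_val, projSet]
  refine (Set.image_congr fun D hD => gate_of_mem σ.isRes (h hD)).trans (Set.image_id _)

end Bldg

namespace Bldg

variable {cs : CoxeterSystem M W} {X : Bldg cs}

variable (X) in
/-- The combinatorial interval of chambers lying on minimal galleries from `C` to `D`. -/
def icc (C D : X.Chamber) : Set X.Chamber :=
  {E | X.gdist C D = X.gdist C E + X.gdist E D}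

theorem left_mem_icc (C D : X.Chamber) : C ∈ X.icc C D := by simp [icc, gdist_self]

theorem right_mem_icc (C D : X.Chamber) : D ∈ X.icc C D := by simp [icc, gdist_self]

theorem icc_symm {C D E : X.Chamber} (h : E ∈ X.icc C D) : E ∈ X.icc D C := by
  simp only [icc, Set.mem_ofPred_eq] at *
  rw [X.gdist_symm C D, X.gdist_symm E D, X.gdist_symm C E, h, add_comm]

theorem icc_trans {C D E F : X.Chamber} (h : E ∈ X.icc C D) (h' : F ∈ X.icc C E) :
    F ∈ X.icc C D := by
  simp only [icc, Set.mem_ofPred_eq] at *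
  have := X.gdist_triangle F E D
  have := X.gdist_triangle C F D
  omega

theorem delta_eq_inv_mul {C D E : X.Chamber} (h : E ∈ X.icc C D) :
    X.delta E D = (X.delta C E)⁻¹ * X.delta C D := by
  rw [X.delta_eq_mul_of_between h]; group

theorem pre_of_mem_icc {C D E : X.Chamber} (h : E ∈ X.icc C D) :
    cs.Pre (X.delta C E) (X.delta C D) := by
  rw [CoxeterSystem.Pre, ← delta_eq_inv_mul h]; exact h

theorem gate_mem_icc {R : Set X.Chamber} (hR : X.IsRes R) {C E : X.Chamber} (hE : E ∈ R) :
    X.gate R C ∈ X.icc C E := gate_between hR hE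

/-- A chamber of an interval is determined by its Weyl distance from an endpoint. -/
theorem eq_of_mem_icc {C D E F : X.Chamber} (hE : E ∈ X.icc C D) (hF : F ∈ X.icc C D)
    (h : X.delta C E = X.delta C F) : E = F := by
  generalize hn : X.gdist C E = n
  induction n generalizing E F with
  | zero =>
    have h1 := X.eq_of_gdist_eq_zero hn
    have h2 : X.gdist C F = 0 := by rw [gdist, ← h]; exact hn
    rw [← h1, ← X.eq_of_gdist_eq_zero h2]
  | succ n ih =>
    have hne : X.delta C E ≠ 1 := by
      intro h1; rw [gdist, h1] at hn; simp at hn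
    obtain ⟨i, hi⟩ := cs.exists_rightDescent_of_ne_one hne
    rw [cs.isRightDescent_iff] at hi
    have step : ∀ G, G ∈ X.icc C D → X.delta C G = X.delta C E → ∃ G', G' ∈ X.icc C D ∧
        X.delta C G' = X.delta C E * cs.simple i ∧ X.gate (X.residue {i} G') D = G := by
      intro G hG hd
      obtain ⟨G', h1, h2⟩ := X.exists_delta C G i
      rw [hd] at h2
      have e1 : X.gdist C G' + 1 = X.gdist C G := by rw [gdist, h2, gdist, hd, hi]
      have e2 : X.gdist G G' = 1 := by rw [gdist, h1, cs.length_simple]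
      have e3 : G' ∈ X.icc C G := by simp only [icc, Set.mem_ofPred_eq, X.gdist_symm G G', e2]; omega
      have e4 := icc_trans hG e3
      have e5 : G ∈ X.residue {i} G' := by
        rw [mem_residue, X.delta_simple_symm h1]; exact cs.simple_mem_par rfl
      refine ⟨G', e4, h2, X.gate_of_lRed e5 ?_⟩
      rintro _ rfl
      rw [cs.not_isLeftInversion_simple_iff, delta_eq_inv_mul hG,
        ← X.delta_simple_symm h1]
      have e6 := delta_eq_inv_mul e4
      rw [X.delta_eq_mul_of_between hG, X.delta_eq_mul_of_between e3] at e6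
      have e7 : X.delta G' D = X.delta G' G * ((X.delta C G)⁻¹ * X.delta C D) := by
        rw [← delta_eq_inv_mul hG, e6]; group
      rw [← e7, ← delta_eq_inv_mul hG]
      change X.gdist G' D = X.gdist G D + 1
      simp only [icc, Set.mem_ofPred_eq] at e4 hG
      omega
    obtain ⟨E', hE1, hE2, hE3⟩ := step E hE rfl
    obtain ⟨F', hF1, hF2, hF3⟩ := step F hF h.symm
    have := ih hE1 hF1 (by rw [hE2, hF2]) (by rw [gdist, hE2]; rw [gdist] at hn; omega)
    rw [← hE3, ← hF3, this]

/-- Every partial isometry from the Coxeter complex extends to an apartment. -/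
theorem exists_isApartMap {Γ : Set (W × X.Chamber)} (hne : Γ.Nonempty)
    (hΓ : ∀ p ∈ Γ, ∀ q ∈ Γ, X.delta p.2 q.2 = p.1⁻¹ * q.1) :
    ∃ α : W → X.Chamber, X.IsApartMap α ∧ ∀ p ∈ Γ, α p.1 = p.2 := by
  obtain ⟨Δ, hsub, hmax⟩ := zorn_subset_nonempty
    {Γ : Set (W × X.Chamber) | ∀ p ∈ Γ, ∀ q ∈ Γ, X.delta p.2 q.2 = p.1⁻¹ * q.1} (by
      intro c hc hchain _
      refine ⟨⋃₀ c, ?_, fun s hs => Set.subset_sUnion_of_mem hs⟩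
      rintro p ⟨s, hs, hp⟩ q ⟨t, ht, hq⟩
      rcases hchain.total hs ht with h | h
      · exact hc ht p (h hp) q hq
      · exact hc hs p hp q (h hq)) Γ hΓ
  have hΔ : ∀ p ∈ Δ, ∀ q ∈ Δ, X.delta p.2 q.2 = p.1⁻¹ * q.1 := hmax.prop
  have ext : ∀ p ∈ Δ, ∀ i, ∃ E, (p.1 * cs.simple i, E) ∈ Δ := by
    rintro ⟨v, C⟩ hp i
    have hred : ∀ E, X.delta C E = cs.simple i → ∀ q ∈ Δ,
        ¬ cs.IsLeftInversion (v⁻¹ * q.1) (cs.simple i) →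
        X.delta E q.2 = cs.simple i * (v⁻¹ * q.1) := by
      intro E hE q hq h
      rw [cs.not_isLeftInversion_simple_iff] at h
      have h1 := hΔ _ hp q hq
      rw [← h1, ← X.delta_simple_symm hE]
      refine X.delta_eq_mul_of_length ?_
      rw [X.delta_simple_symm hE, gdist, h1, h, cs.length_simple, add_comm]
    obtain ⟨E, hE⟩ : ∃ E, ∀ q ∈ Δ, X.delta E q.2 = cs.simple i * (v⁻¹ * q.1) := by
      by_cases hc : ∃ q ∈ Δ, cs.IsLeftInversion (v⁻¹ * q.1) (cs.simple i)
      · obtain ⟨q₀, hq₀, hinv⟩ := hc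
        obtain ⟨E, hE, hE'⟩ := X.exists_delta_left C q₀.2 i
        have h0 := hΔ _ hp _ hq₀
        refine ⟨E, fun q hq => ?_⟩
        by_cases h : cs.IsLeftInversion (v⁻¹ * q.1) (cs.simple i)
        · have h1 := hΔ _ hp q hq
          have h2 := X.delta_mem_pair q.2 C E i hE
          rw [X.delta_symm C, X.delta_symm E, h1] at h2
          rcases h2 with h2 | h2
          · have := congrArg (·⁻¹) h2
            simpa using this
          · exfalso
            have h3 : X.delta E q.2 = v⁻¹ * q.1 := inv_injective h2
            have h4 := X.gdist_retraction_le E q.2 q₀.2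
            have h5 := hΔ q hq _ hq₀
            rw [hE', h3, gdist, h5, h0] at h4
            have h6 := cs.length_lt_of_isLeftInversion_both h hinv
            simp only [mul_inv_rev, inv_inv, mul_assoc, mul_inv_cancel_left] at h4 h6
            omega
        · exact hred E hE q hq h
      · obtain ⟨E, hE, -⟩ := X.exists_delta C C i
        exact ⟨E, fun q hq => hred E hE q hq fun h => hc ⟨q, hq, h⟩⟩
    refine ⟨E, ?_⟩
    have hins : insert (v * cs.simple i, E) Δ ∈
        {Γ : Set (W × X.Chamber) | ∀ p ∈ Γ, ∀ q ∈ Γ, X.delta p.2 q.2 = p.1⁻¹ * q.1} := by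
      rintro p (rfl | hp') q (rfl | hq')
      · simp [delta_self]
      · simp [hE q hq', mul_assoc]
      · rw [X.delta_symm E, hE p hp']; simp [mul_assoc]
      · exact hΔ p hp' q hq'
    exact hmax.le_of_ge hins (Set.subset_insert _ _) (Set.mem_insert _ _)
  have htot : ∀ w, ∃ E, (w, E) ∈ Δ := by
    obtain ⟨⟨v, C⟩, hp⟩ := hne
    have : ∀ w, ∃ E, (v * w, E) ∈ Δ := by
      intro w
      induction w using cs.simple_induction_right with
      | one => exact ⟨C, by simpa using hsub hp⟩
      | mul_simple_right w i ih =>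
        obtain ⟨E, hE⟩ := ih
        simpa [mul_assoc] using ext _ hE i
    intro w
    simpa using this (v⁻¹ * w)
  choose α hα using htot
  have h1 : ∀ v w, X.delta (α v) (α w) = v⁻¹ * w := fun v w => hΔ _ (hα v) _ (hα w)
  refine ⟨α, ⟨fun v w h => ?_, h1⟩, fun p hp => ?_⟩
  · have := h1 v w
    rw [h, delta_self] at this
    exact inv_mul_eq_one.1 this.symm
  · have := hΔ _ (hα p.1) _ (hsub hp)
    simp only [inv_mul_cancel, X.delta_eq_one_iff] at this
    exact this

theorem exists_isApartMap_pair (C D : X.Chamber) :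
    ∃ α : W → X.Chamber, X.IsApartMap α ∧ α 1 = C ∧ α (X.delta C D) = D := by
  obtain ⟨α, h, h'⟩ := exists_isApartMap (X := X) (Γ := {(1, C), (X.delta C D, D)}) ⟨_, Or.inl rfl⟩
    (by
      rintro p (rfl | rfl) q (rfl | rfl)
      · simp [delta_self]
      · simp
      · rw [delta_symm]; simp
      · simp [delta_self])
  exact ⟨α, h, h' (1, C) (Or.inl rfl), h' (_, D) (Or.inr rfl)⟩

theorem IsApartMap.apply_of_mem_icc {α : W → X.Chamber} (hα : X.IsApartMap α) {v w : W}
    {E : X.Chamber} (h : E ∈ X.icc (α v) (α w)) : α (v * X.delta (α v) E) = E := by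
  have h1 : X.delta (α v) (α (v * X.delta (α v) E)) = X.delta (α v) E := by
    rw [hα.2]; group
  refine eq_of_mem_icc (C := α v) (D := α w) ?_ h h1
  have h2 := delta_eq_inv_mul h
  have h3 : X.delta (α (v * X.delta (α v) E)) (α w) = X.delta E (α w) := by
    rw [hα.2, h2, hα.2]; group
  simp only [icc, Set.mem_ofPred_eq] at *
  rw [h, gdist, gdist, gdist, gdist, h1, h3]

theorem delta_of_mem_icc {C D E F : X.Chamber} (hE : E ∈ X.icc C D) (hF : F ∈ X.icc C D) :
    X.delta E F = (X.delta C E)⁻¹ * X.delta C F := by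
  obtain ⟨α, hα, h1, h2⟩ := exists_isApartMap_pair C D
  have h3 : E ∈ X.icc (α 1) (α (X.delta C D)) := by rwa [h1, h2]
  have h4 : F ∈ X.icc (α 1) (α (X.delta C D)) := by rwa [h1, h2]
  have h5 := hα.apply_of_mem_icc h3
  have h6 := hα.apply_of_mem_icc h4
  have h7 := hα.2 (1 * X.delta (α 1) E) (1 * X.delta (α 1) F)
  rwa [h5, h6, h1, one_mul, one_mul] at h7

theorem icc_convex {C D E F G : X.Chamber} (hE : E ∈ X.icc C D) (hF : F ∈ X.icc C D)
    (hG : G ∈ X.icc E F) : G ∈ X.icc C D := by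
  obtain ⟨α, hα, h1, h2⟩ := exists_isApartMap_pair C D
  have h3 : E ∈ X.icc (α 1) (α (X.delta C D)) := by rwa [h1, h2]
  have h4 : F ∈ X.icc (α 1) (α (X.delta C D)) := by rwa [h1, h2]
  have h5 := hα.apply_of_mem_icc h3
  have h6 := hα.apply_of_mem_icc h4
  rw [h1, one_mul] at h5 h6
  have hG' : G ∈ X.icc (α (X.delta C E)) (α (X.delta C F)) := by rwa [h5, h6]
  have h7 := hα.apply_of_mem_icc hG'
  set g := X.delta C E * X.delta (α (X.delta C E)) G with hg
  have h8 : cs.Pre g (X.delta C D) := by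
    refine cs.pre_of_between (pre_of_mem_icc hE) (pre_of_mem_icc hF) ?_
    rw [← hα.2, ← hα.2, ← hα.2, h7]
    exact hG'
  have h9 : X.delta C G = g := by
    have := hα.2 1 g
    rwa [h1, h7, inv_one, one_mul] at this
  have h10 : X.delta G D = g⁻¹ * X.delta C D := by
    have := hα.2 g (X.delta C D)
    rwa [h7, h2] at this
  rw [CoxeterSystem.Pre, ← h10, ← h9] at h8
  exact h8

theorem exists_mem_icc_of_mem_conv2 {σ R x : X.Res} (hx : x ∈ X.conv2 σ R) {C D : X.Chamber}
    (hC : C ∈ σ.1) (hD : D ∈ R.1) : ∃ E ∈ x.1, E ∈ X.icc C D := by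
  refine hx {x | ∃ E ∈ x.1, E ∈ X.icc C D} ⟨⟨?_, ?_⟩, ?_⟩
  · rintro R₁ R₂ h ⟨E, hE, hE'⟩
    exact ⟨E, h hE, hE'⟩
  · rintro R₁ ⟨E, hE, hE'⟩ R₂ ⟨F, hF, hF'⟩
    exact ⟨X.gate R₁.1 F, mem_projRes.2 ⟨F, hF, rfl⟩,
      icc_convex hF' hE' (gate_mem_icc R₁.isRes hE)⟩
  · rintro _ (rfl | rfl)
    · exact ⟨C, hC, left_mem_icc _ _⟩
    · exact ⟨D, hD, right_mem_icc _ _⟩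

theorem gate_mem_icc_of_mem_conv2 {σ R x : X.Res} (hx : x ∈ X.conv2 σ R) {C D : X.Chamber}
    (hC : C ∈ σ.1) (hD : D ∈ R.1) : X.gate x.1 C ∈ X.icc C D := by
  obtain ⟨E, hE, hE'⟩ := exists_mem_icc_of_mem_conv2 hx hC hD
  exact icc_trans hE' (gate_mem_icc x.isRes hE)

end Bldg

theorem CoxeterSystem.pre_mul (cs : CoxeterSystem M W) {v q u : W}
    (h : cs.length (v * u) = cs.length v + cs.length u) (hq : cs.Pre q u) :
    cs.length (v * q) = cs.length v + cs.length q ∧ cs.Pre (v * q) (v * u) := by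
  have h1 : (v * q)⁻¹ * (v * u) = q⁻¹ * u := by group
  have h2 := cs.length_mul_le v q
  have h3 := cs.length_mul_le (v * q) (q⁻¹ * u)
  rw [show v * q * (q⁻¹ * u) = v * u by group] at h3
  simp only [Pre, h1] at *
  omega

namespace Bldg

variable {cs : CoxeterSystem M W} {X : Bldg cs}

theorem convSeq_iff {ξ : X.Res → X.Res} {R : ℕ → X.Res} :
    X.ConvSeq ξ R ↔ ∀ σ, ∀ᶠ n in atTop, X.projRes σ (R n) = ξ σ := by
  rw [ConvSeq, tendsto_pi_nhds]
  refine forall_congr' fun σ => ?_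
  rw [nhds_discrete, tendsto_pure]
  rfl

theorem left_mem_conv2 (x R : X.Res) : x ∈ X.conv2 x R := fun _ h => h.2 (Or.inl rfl)

theorem right_mem_conv2 (x R : X.Res) : R ∈ X.conv2 x R := fun _ h => h.2 (Or.inr rfl)

theorem mem_conv2_of_subset {x R ρ σ : X.Res} (h : ρ ∈ X.conv2 x R) (h' : ρ.1 ⊆ σ.1) :
    σ ∈ X.conv2 x R := fun s hs => hs.1.1 _ _ h' (h s hs)

theorem projRes_mem_conv2 {x R ρ σ : X.Res} (h : ρ ∈ X.conv2 x R) (h' : σ ∈ X.conv2 x R) :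
    X.projRes ρ σ ∈ X.conv2 x R := fun s hs => hs.1.2 _ (h s hs) _ (h' s hs)

theorem conv2_trans {x y z R : X.Res} (h : y ∈ X.conv2 x R) (h' : z ∈ X.conv2 y R) :
    z ∈ X.conv2 x R := fun s hs => h' s ⟨hs.1, by
  rintro _ (rfl | rfl)
  · exact h s hs
  · exact hs.2 (Or.inr rfl)⟩

theorem mem_Qseq {x z : X.Res} {R : ℕ → X.Res} :
    z ∈ X.Qseq x R ↔ ∀ᶠ m in atTop, z ∈ X.conv2 x (R m) := by
  simp [Qseq, eventually_atTop]

theorem mem_Qseq_self (x : X.Res) (R : ℕ → X.Res) : x ∈ X.Qseq x R :=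
  mem_Qseq.2 (.of_forall fun _ => left_mem_conv2 _ _)

theorem mem_Qseq_trans {x y z : X.Res} {R : ℕ → X.Res} (h : y ∈ X.Qseq x R)
    (h' : z ∈ X.Qseq y R) : z ∈ X.Qseq x R := by
  rw [mem_Qseq] at *
  filter_upwards [h, h'] with m h h' using conv2_trans h h'

/-- If `x` is its own projection of `R` and lies in the hull of `σ` and `R`, then `x` and `R` have
the same projection to `σ`. -/
theorem projRes_eq_of_mem_conv2 {σ x R : X.Res} (hx : x ∈ X.conv2 σ R) (h : X.projRes x R = x) :
    X.projRes σ x = X.projRes σ R := by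
  apply Res.ext'
  have hx' : x.1 = X.gate x.1 '' R.1 := by
    conv_lhs => rw [← h, projRes_val, projSet]
  rw [projRes_val, projRes_val, projSet, projSet]
  conv_lhs => rw [hx']
  rw [Set.image_image]
  refine Set.image_congr fun D hD => ?_
  obtain ⟨E, hE, hE'⟩ := exists_mem_icc_of_mem_conv2 hx (gate_mem σ.isRes D) hD
  exact gate_of_between σ.isRes (icc_trans (icc_symm hE') (gate_mem_icc x.isRes hE))

variable (X) in
/-- A chamber, viewed as a residue. -/
def chRes (c : X.Chamber) : X.Res :=
  ⟨{c}, ∅, c, by simp [SphType], by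
    ext D
    simp [residue, Subgroup.mem_bot, X.delta_eq_one_iff, eq_comm]⟩

theorem chRes_val (c : X.Chamber) : (X.chRes c).1 = {c} := rfl

/-- The full type of a spherical residue. -/
theorem Res.exists_type (R : X.Res) : ∃ I : Set B, SphType cs I ∧
    (∀ i, cs.simple i ∈ cs.par I → i ∈ I) ∧ ∀ C ∈ R.1, R.1 = X.residue I C := by
  obtain ⟨I, A, hI, h⟩ := R.2
  have h1 : cs.par {i | cs.simple i ∈ cs.par I} = cs.par I := by
    refine le_antisymm ?_ (cs.par_mono fun i hi => cs.simple_mem_par hi)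
    rw [CoxeterSystem.par, Subgroup.closure_le]
    rintro _ ⟨i, hi, rfl⟩
    exact hi
  have h2 : ∀ C, X.residue {i | cs.simple i ∈ cs.par I} C = X.residue I C := fun C => by
    ext D; rw [mem_residue, mem_residue, h1]
  refine ⟨{i | cs.simple i ∈ cs.par I}, ?_, ?_, ?_⟩
  · simp only [SphType] at hI ⊢
    have := congrArg (fun H : Subgroup W => (H : Set W)) h1
    change ((cs.par {i | cs.simple i ∈ cs.par I} : Subgroup W) : Set W) = (cs.par I : Set W) at this
    rwa [this]
  · intro i hi
    rw [h1] at hi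
    exact hi
  · intro C hC
    rw [h2, h]
    rw [h] at hC
    exact (X.residue_eq_of_mem hC).symm

theorem exists_forall_pre (R : X.Res) (c : X.Chamber) :
    ∃ u, ∀ D ∈ R.1, cs.Pre (X.delta c D) u := by
  obtain ⟨J, hJ, -, hR⟩ := R.exists_type
  set G := X.gate R.1 c with hG
  have hGR : G ∈ R.1 := gate_mem R.isRes c
  have hRG := hR G hGR
  obtain ⟨u, hu, hmax⟩ := cs.exists_longest hJ
  have hred : cs.LRed J (X.delta G c) := by
    refine X.lRed_of_gate (A := G) (X.self_mem_residue J G) ?_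
    rw [← hRG]
  rw [delta_symm] at hred
  have hl := CoxeterSystem.LRed.length_mul_right cs hred hu
  refine ⟨X.delta c G * u, fun D hD => ?_⟩
  rw [X.delta_eq_mul_of_between (gate_between R.isRes hD)]
  refine (cs.pre_mul hl (hmax _ ?_)).2
  rw [hRG] at hD
  exact hD

section Sector

variable {ξ : X.Res → X.Res} {R : ℕ → X.Res}

theorem xi_subset (hR : X.ConvSeq ξ R) (σ : X.Res) : (ξ σ).1 ⊆ σ.1 := by
  obtain ⟨m, hm⟩ := (convSeq_iff.1 hR σ).exists
  rw [← hm]; exact projRes_subset _ _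

theorem xi_of_subset (hR : X.ConvSeq ξ R) {ρ σ : X.Res} (h : ρ.1 ⊆ σ.1) :
    X.projRes ρ (ξ σ) = ξ ρ := by
  obtain ⟨m, hm, hm'⟩ := ((convSeq_iff.1 hR σ).and (convSeq_iff.1 hR ρ)).exists
  rw [← hm, ← hm', projRes_projRes_of_subset h]

theorem xi_xi (hR : X.ConvSeq ξ R) (σ : X.Res) : ξ (ξ σ) = ξ σ := by
  rw [← xi_of_subset hR (xi_subset hR σ)]
  exact projRes_self_of_subset subset_rfl

theorem xi_chRes (hR : X.ConvSeq ξ R) (c : X.Chamber) : ξ (X.chRes c) = X.chRes c := by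
  apply Res.ext'
  exact (Set.Nonempty.subset_singleton_iff (ξ _).nonempty).1 (xi_subset hR _)

theorem xi_mem_Qseq (hR : X.ConvSeq ξ R) {x σ : X.Res} (h : x.1 ⊆ σ.1) : ξ σ ∈ X.Qseq x R := by
  rw [mem_Qseq]
  filter_upwards [convSeq_iff.1 hR σ] with m hm
  rw [← hm]
  exact projRes_mem_conv2 (mem_conv2_of_subset (left_mem_conv2 _ _) h) (right_mem_conv2 _ _)

theorem convSeq_of_eventually_mem_Qseq (hR : X.ConvSeq ξ R) {x : ℕ → X.Res}
    (hx : ∀ n, ξ (x n) = x n) (h : ∀ y : X.Res, ∀ᶠ n in atTop, x n ∈ X.Qseq y R) :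
    X.ConvSeq ξ x := by
  rw [convSeq_iff]
  intro σ
  filter_upwards [h σ] with n hn
  obtain ⟨m, ⟨h1, h2⟩, h3⟩ := (((mem_Qseq.1 hn).and (convSeq_iff.1 hR (x n))).and
    (convSeq_iff.1 hR σ)).exists
  rw [← h3]
  exact projRes_eq_of_mem_conv2 h1 (h2.trans (hx n))

/-- `y` is the value of `ξ` at a residue containing the chambers of `x`. -/
def Move (ξ : X.Res → X.Res) (x y : X.Res) : Prop := ∃ σ : X.Res, x.1 ⊆ σ.1 ∧ y = ξ σ

/-- The residues reached from `x` by finitely many moves towards `ξ`. -/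
abbrev Desc (ξ : X.Res → X.Res) : X.Res → X.Res → Prop := Relation.ReflTransGen (Move ξ)

theorem Desc.mem_Qseq (hR : X.ConvSeq ξ R) {x z : X.Res} (h : Desc ξ x z) : z ∈ X.Qseq x R := by
  induction h with
  | refl => exact mem_Qseq_self _ _
  | tail _ h ih =>
    obtain ⟨σ, hσ, rfl⟩ := h
    exact mem_Qseq_trans ih (xi_mem_Qseq hR hσ)

theorem Desc.fixed (hR : X.ConvSeq ξ R) {x z : X.Res} (h : Desc ξ x z) (hx : ξ x = x) :
    ξ z = z := by
  induction h with
  | refl => exact hx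
  | tail _ h ih =>
    obtain ⟨σ, hσ, rfl⟩ := h
    exact xi_xi hR σ

theorem Desc.exists_ne {x z : X.Res} (h : Desc ξ x z) :
    z = x ∨ ∃ y, Move ξ x y ∧ y ≠ x ∧ Desc ξ y z := by
  induction h using Relation.ReflTransGen.head_induction_on with
  | refl => exact Or.inl rfl
  | head h h' ih =>
    rename_i a c
    by_cases hc : c = a
    · subst hc; exact ih
    · exact Or.inr ⟨c, h, hc, h'⟩

theorem gate_mem_icc_of_mem_xi (hR : X.ConvSeq ξ R) {c : X.Chamber} {x σ : X.Res}
    (hx : x ∈ X.Qseq (X.chRes c) R) (hσ : x.1 ⊆ σ.1) {f : X.Chamber} (hf : f ∈ (ξ σ).1) :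
    X.gate x.1 c ∈ X.icc c f := by
  obtain ⟨m, h1, h2⟩ := ((mem_Qseq.1 hx).and (convSeq_iff.1 hR σ)).exists
  rw [← h2, mem_projRes] at hf
  obtain ⟨D, hD, rfl⟩ := hf
  have h3 := gate_mem_icc_of_mem_conv2 h1 (C := c) rfl hD
  have h4 : X.gate x.1 c ∈ σ.1 := hσ (gate_mem x.isRes c)
  have h5 := icc_symm (gate_mem_icc σ.isRes h4 (C := D))
  simp only [icc, Set.mem_ofPred_eq] at *
  have := X.gdist_triangle c (X.gate σ.1 D) D
  have := X.gdist_triangle c (X.gate x.1 c) (X.gate σ.1 D)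
  omega

theorem gate_mem_icc_of_mem_xi' (hR : X.ConvSeq ξ R) {c : X.Chamber} {x σ : X.Res}
    (hx : x ∈ X.Qseq (X.chRes c) R) (hσ : x.1 ⊆ σ.1) {f : X.Chamber} (hf : f ∈ (ξ σ).1) :
    X.gate x.1 f ∈ X.icc c f := by
  have h1 := gate_mem_icc_of_mem_xi hR hx hσ hf
  have h2 := icc_symm (gate_mem_icc x.isRes (gate_mem x.isRes c) (C := f))
  exact icc_symm (icc_trans (icc_symm h1) (icc_symm h2))

theorem Move.exists_pre (hR : X.ConvSeq ξ R) {c : X.Chamber} {x y : X.Res}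
    (hx : x ∈ X.Qseq (X.chRes c) R) (hxx : ξ x = x) (h : Move ξ x y) {e : X.Chamber}
    (he : e ∈ x.1) : ∃ f ∈ y.1, cs.Pre (X.delta c e) (X.delta c f) := by
  obtain ⟨σ, hσ, rfl⟩ := h
  rw [← hxx, ← xi_of_subset hR hσ, mem_projRes] at he
  obtain ⟨f, hf, rfl⟩ := he
  exact ⟨f, hf, pre_of_mem_icc (gate_mem_icc_of_mem_xi' hR hx hσ hf)⟩

theorem Desc.exists_pre (hR : X.ConvSeq ξ R) {c : X.Chamber} {x z : X.Res}
    (hx : Desc ξ (X.chRes c) x) (h : Desc ξ x z) {e : X.Chamber}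
    (he : e ∈ x.1) : ∃ f ∈ z.1, cs.Pre (X.delta c e) (X.delta c f) := by
  induction h with
  | refl => exact ⟨e, he, cs.pre_refl _⟩
  | tail h h' ih =>
    obtain ⟨f, hf, hp⟩ := ih
    have h1 : Desc ξ (X.chRes c) _ := hx.trans h
    obtain ⟨g, hg, hp'⟩ := Move.exists_pre hR (Desc.mem_Qseq hR h1) (Desc.fixed hR h1 (xi_chRes hR c)) h' hf
    exact ⟨g, hg, cs.pre_trans hp hp'⟩

variable (X) in
/-- The chambers at Weyl distance `≤ u` from `c` in the prefix order. -/
def preBall (c : X.Chamber) (u : W) : Set X.Chamber := {f | cs.Pre (X.delta c f) u}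

theorem Desc.subset_preBall (hR : X.ConvSeq ξ R) {c : X.Chamber} {x z : X.Res} {u : W}
    (hx : Desc ξ (X.chRes c) x) (h : Desc ξ x z) (hz : z.1 ⊆ X.preBall c u) :
    x.1 ⊆ X.preBall c u := fun e he => by
  obtain ⟨f, hf, hp⟩ := hx.exists_pre hR h he
  exact cs.pre_trans hp (hz hf)

end Sector

end Bldg

theorem CoxeterSystem.isLeftInversion_simple_self (cs : CoxeterSystem M W) (i : B) :
    cs.IsLeftInversion (cs.simple i) (cs.simple i) :=
  ⟨cs.isReflection_simple i, by simp⟩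

theorem CoxeterSystem.simple_ne_one (cs : CoxeterSystem M W) (i : B) : cs.simple i ≠ 1 := fun h => by
  have := cs.length_simple i
  simp [h] at this

namespace Bldg

variable {cs : CoxeterSystem M W} {X : Bldg cs}

variable (X) in
theorem exists_delta_eq_simple (e : X.Chamber) (i : B) : ∃ f, X.delta e f = cs.simple i := by
  obtain ⟨f, hf, -⟩ := X.exists_delta e e i
  exact ⟨f, hf⟩

theorem residue_mono {I J : Set B} (h : I ⊆ J) (e : X.Chamber) :
    X.residue I e ⊆ X.residue J e := fun _ hD => cs.par_mono h hD

theorem type_subset {I J : Set B} {e : X.Chamber} (h : X.residue J e ⊆ X.residue I e)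
    (hI : ∀ i, cs.simple i ∈ cs.par I → i ∈ I) : J ⊆ I := fun j hj => by
  obtain ⟨f, hf⟩ := X.exists_delta_eq_simple e j
  have h1 : f ∈ X.residue J e := by rw [mem_residue, hf]; exact cs.simple_mem_par hj
  have h2 := h h1
  rw [mem_residue, hf] at h2
  exact hI j h2

theorem exists_simple_notMem {K J : Set B} {e : X.Chamber}
    (h : ¬ X.residue K e ⊆ X.residue J e) : ∃ k ∈ K, cs.simple k ∉ cs.par J := by
  by_contra! hc
  refine h fun D hD => ?_
  have : cs.par K ≤ cs.par J := by
    rw [CoxeterSystem.par, Subgroup.closure_le]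
    rintro _ ⟨k, hk, rfl⟩
    exact hc k hk
  exact this hD

section Sector

variable {ξ : X.Res → X.Res} {R : ℕ → X.Res}

/-- `ξ σ` is never a proper subset of a residue `x ⊆ σ` fixed by `ξ`. -/
theorem eq_of_xi_subset (hR : X.ConvSeq ξ R) {x σ : X.Res} (hx : ξ x = x) (hσ : x.1 ⊆ σ.1)
    (h : (ξ σ).1 ⊆ x.1) : ξ σ = x := by
  have h1 := xi_of_subset hR hσ
  rwa [projRes_self_of_subset h, hx] at h1

theorem gate_gate_xi (hR : X.ConvSeq ξ R) {x σ : X.Res} (hx : ξ x = x) (hσ : x.1 ⊆ σ.1)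
    {e : X.Chamber} (he : e ∈ x.1) : X.gate x.1 (X.gate (ξ σ).1 e) = e := by
  refine gate_gate_of_mem_projSet x.isRes (ξ σ).isRes ?_
  rw [← projRes_val, xi_of_subset hR hσ, hx]
  exact he

/-- A nontrivial move factors through a move of corank one. -/
theorem exists_step (hR : X.ConvSeq ξ R) {x σ : X.Res} (hx : ξ x = x) {J : Set B}
    (hJ : ∀ e ∈ x.1, x.1 = X.residue J e) (hσ : x.1 ⊆ σ.1) (hne : ξ σ ≠ x) :
    ∃ (s : B) (τ : X.Res), (∀ e ∈ x.1, τ.1 = X.residue (insert s J) e) ∧ x.1 ⊆ τ.1 ∧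
      τ.1 ⊆ σ.1 ∧ ξ τ ≠ x := by
  have build : ∀ (ρ : X.Res) (I : Set B), SphType cs I → (∀ i, cs.simple i ∈ cs.par I → i ∈ I) →
      (∀ C ∈ ρ.1, ρ.1 = X.residue I C) → x.1 ⊆ ρ.1 → ∀ s ∈ I, ∃ τ : X.Res,
      (∀ e ∈ x.1, τ.1 = X.residue (insert s J) e) ∧ x.1 ⊆ τ.1 ∧ τ.1 ⊆ ρ.1 := by
    intro ρ I hI hI' hρ hxρ s hs
    obtain ⟨e, he⟩ := x.nonempty
    have hJI : J ⊆ I := type_subset (e := e) (by rw [← hJ e he, ← hρ e (hxρ he)]; exact hxρ) hI'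
    have hsub : insert s J ⊆ I := Set.insert_subset hs hJI
    have hxt : x.1 ⊆ X.residue (insert s J) e := by
      rw [hJ e he]; exact residue_mono (Set.subset_insert _ _) e
    refine ⟨⟨X.residue (insert s J) e, _, e, hI.mono hsub, rfl⟩, fun e' he' => ?_, hxt, ?_⟩
    · exact (X.residue_eq_of_mem (hxt he')).symm
    · change X.residue (insert s J) e ⊆ ρ.1
      rw [hρ e (hxρ he)]; exact residue_mono hsub e
  obtain ⟨I, hI, hI', hσI⟩ := σ.exists_type
  by_cases hA : ∀ e ∈ x.1, X.gate (ξ σ).1 e = e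
  · have hxa : x.1 ⊆ (ξ σ).1 := fun e he => by
      rw [← hA e he]; exact gate_mem (ξ σ).isRes e
    obtain ⟨K, hK, hK', haK⟩ := (ξ σ).exists_type
    obtain ⟨e, he⟩ := x.nonempty
    obtain ⟨k, hk, hkJ⟩ : ∃ k ∈ K, cs.simple k ∉ cs.par J := by
      refine exists_simple_notMem (X := X) (e := e) fun h => hne ?_
      rw [← haK e (hxa he), ← hJ e he] at h
      exact eq_of_xi_subset hR hx hσ h
    obtain ⟨τ, hτ, hxτ, hτa⟩ := build (ξ σ) K hK hK' haK hxa k hk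
    have hτσ := hτa.trans (xi_subset hR σ)
    refine ⟨k, τ, hτ, hxτ, hτσ, fun h => ?_⟩
    have h1 : ξ τ = τ := by
      refine Res.ext' ((xi_subset hR τ).antisymm fun D hD => ?_)
      rw [← xi_of_subset hR hτσ, mem_projRes]
      exact ⟨D, hτa hD, gate_of_mem τ.isRes hD⟩
    rw [h1] at h
    obtain ⟨f, hf⟩ := X.exists_delta_eq_simple e k
    have h2 : f ∈ τ.1 := by
      rw [hτ e he, mem_residue, hf]; exact cs.simple_mem_par (Set.mem_insert _ _)
    rw [h, hJ e he, mem_residue, hf] at h2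
    exact hkJ h2
  · push Not at hA
    obtain ⟨e, he, hne'⟩ := hA
    set f := X.gate (ξ σ).1 e with hf
    have hfa : f ∈ (ξ σ).1 := gate_mem (ξ σ).isRes e
    have hp : X.delta e f ∈ cs.par I := by
      have := xi_subset hR σ hfa
      rwa [hσI e (hσ he)] at this
    have hp1 : X.delta e f ≠ 1 := fun h => hne' ((X.delta_eq_one_iff _ _).1 h).symm
    obtain ⟨s, hs, hinv⟩ := cs.exists_descent_of_mem_par hp hp1
    obtain ⟨τ, hτ, hxτ, hτσ⟩ := build σ I hI hI' hσI hσ s hs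
    refine ⟨s, τ, hτ, hxτ, hτσ, fun h => ?_⟩
    have h1 : X.gate τ.1 f ∈ x.1 := by
      rw [← h, ← xi_of_subset hR hτσ, mem_projRes]
      exact ⟨f, hfa, rfl⟩
    have h2 := gate_gate x.isRes τ.isRes hxτ f
    rw [gate_of_mem x.isRes h1, hf, gate_gate_xi hR hx hσ he, ← hf, hτ e he] at h2
    exact X.lRed_of_gate (X.self_mem_residue _ _) h2 s (Set.mem_insert _ _) hinv

theorem exists_isLeftInversion (hR : X.ConvSeq ξ R) {x τ : X.Res} (hx : ξ x = x) {J : Set B}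
    {s : B} {e : X.Chamber} (he : e ∈ x.1) (hJ : x.1 = X.residue J e)
    (hτ : τ.1 = X.residue (insert s J) e) (hxτ : x.1 ⊆ τ.1) (hne : ξ τ ≠ x) :
    ∃ f ∈ (ξ τ).1, X.gate x.1 f = e ∧ cs.IsLeftInversion (X.delta e f) (cs.simple s) := by
  by_cases hea : e ∈ (ξ τ).1
  · obtain ⟨K, -, -, haK⟩ := (ξ τ).exists_type
    obtain ⟨k, hk, hkJ⟩ : ∃ k ∈ K, cs.simple k ∉ cs.par J := by
      refine exists_simple_notMem (X := X) (e := e) fun h => hne ?_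
      rw [← haK e hea, ← hJ] at h
      exact eq_of_xi_subset hR hx hxτ h
    obtain ⟨f, hf⟩ := X.exists_delta_eq_simple e k
    have hfa : f ∈ (ξ τ).1 := by
      rw [haK e hea, mem_residue, hf]; exact cs.simple_mem_par hk
    have h1 : cs.simple k ∈ cs.par (insert s J) := by
      rw [← hf]
      have := xi_subset hR τ hfa
      rwa [hτ] at this
    obtain ⟨i, hi, hinv⟩ := cs.exists_descent_of_mem_par h1 (cs.simple_ne_one k)
    have h2 := cs.isLeftInversion_simple_right hinv
    refine ⟨f, hfa, ?_, ?_⟩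
    · rw [hJ]
      refine X.gate_of_lRed (X.self_mem_residue _ _) fun j hj hj' => hkJ ?_
      rw [hf] at hj'
      rw [← cs.isLeftInversion_simple_right hj']
      exact cs.simple_mem_par hj
    · rcases hi with rfl | hi
      · rwa [hf]
      · exact absurd (h2 ▸ cs.simple_mem_par hi) hkJ
  · have hfa := gate_mem (ξ τ).isRes e
    have hg := gate_gate_xi hR hx hxτ he
    refine ⟨_, hfa, hg, ?_⟩
    have hp : X.delta e (X.gate (ξ τ).1 e) ∈ cs.par (insert s J) := by
      have := xi_subset hR τ hfa
      rwa [hτ] at this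
    have hp1 : X.delta e (X.gate (ξ τ).1 e) ≠ 1 := fun h => hea (by
      rw [X.delta_eq_one_iff] at h
      rw [h]; exact hfa)
    obtain ⟨i, hi, hinv⟩ := cs.exists_descent_of_mem_par hp hp1
    rcases hi with rfl | hi
    · exact hinv
    · rw [hJ] at hg
      exact absurd hinv (X.lRed_of_gate (X.self_mem_residue _ _) hg i hi)

theorem pre_of_mem_preBall {c e f : X.Chamber} {u : W} (he : e ∈ X.icc c f)
    (hf : f ∈ X.preBall c u) : cs.Pre (X.delta e f) ((X.delta c e)⁻¹ * u) := by
  rw [delta_eq_inv_mul he]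
  exact cs.pre_inv_mul (pre_of_mem_icc he) hf

theorem exists_move_move (hR : X.ConvSeq ξ R) {c : X.Chamber} {u : W} {x τ τ' : X.Res}
    (hx : Desc ξ (X.chRes c) x) {J : Set B} {s t : B} (hJ : ∀ e ∈ x.1, x.1 = X.residue J e)
    (hs : ∀ e ∈ x.1, τ.1 = X.residue (insert s J) e)
    (ht : ∀ e ∈ x.1, τ'.1 = X.residue (insert t J) e)
    (hxs : x.1 ⊆ τ.1) (hxt : x.1 ⊆ τ'.1) (hns : ξ τ ≠ x) (hnt : ξ τ' ≠ x)
    (hus : (ξ τ).1 ⊆ X.preBall c u) (hut : (ξ τ').1 ⊆ X.preBall c u) :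
    ∃ q, Move ξ (ξ τ) q ∧ Move ξ (ξ τ') q ∧ q.1 ⊆ X.preBall c u := by
  have hxx := Desc.fixed hR hx (xi_chRes hR c)
  have hxQ := Desc.mem_Qseq hR hx
  have hux := Desc.subset_preBall hR hx (.single ⟨τ, hxs, rfl⟩) hus
  set e := X.gate x.1 c with he'
  have he : e ∈ x.1 := gate_mem x.isRes c
  have hve : cs.Pre (X.delta c e) u := hux he
  have key : ∀ (τ : X.Res) (s : B), (∀ e ∈ x.1, τ.1 = X.residue (insert s J) e) → x.1 ⊆ τ.1 →
      ξ τ ≠ x → (ξ τ).1 ⊆ X.preBall c u →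
      cs.IsLeftInversion ((X.delta c e)⁻¹ * u) (cs.simple s) := by
    intro τ s hs hxs hns hus
    obtain ⟨f, hf, hg, hinv⟩ := exists_isLeftInversion hR hxx he (hJ e he) (hs e he) hxs hns
    have h1 := gate_mem_icc_of_mem_xi' hR hxQ hxs hf
    rw [hg] at h1
    exact cs.pre_iff.1 (pre_of_mem_preBall h1 (hus hf)) _ hinv
  have hL : ∀ l ∈ insert t (insert s J),
      cs.IsLeftInversion ((X.delta c e)⁻¹ * u) (cs.simple l) := by
    rintro l (rfl | rfl | hl)
    · exact key τ' l ht hxt hnt hut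
    · exact key τ l hs hxs hns hus
    · obtain ⟨f, hf⟩ := X.exists_delta_eq_simple e l
      have hfx : f ∈ x.1 := by
        rw [hJ e he, mem_residue, hf]; exact cs.simple_mem_par hl
      have h1 := pre_of_mem_preBall (gate_mem_icc x.isRes hfx) (hux hfx)
      rw [← he', hf] at h1
      exact cs.pre_iff.1 h1 _ (cs.isLeftInversion_simple_self l)
  let ρ : X.Res := ⟨X.residue (insert t (insert s J)) e, _, e, cs.sphType_of_descents hL, rfl⟩
  have hρ : ρ.1 = X.residue (insert t (insert s J)) e := rfl
  refine ⟨ξ ρ, ⟨ρ, ?_, rfl⟩, ⟨ρ, ?_, rfl⟩, (xi_subset hR ρ).trans fun D hD => ?_⟩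
  · refine (xi_subset hR τ).trans ?_
    rw [hs e he]
    exact residue_mono (Set.subset_insert _ _) e
  · refine (xi_subset hR τ').trans ?_
    rw [ht e he]
    exact residue_mono (Set.insert_subset_insert (Set.subset_insert _ _)) e
  · rw [hρ, mem_residue] at hD
    have h1 := cs.pre_of_descents hL hD
    have h2 : cs.length (X.delta c e * ((X.delta c e)⁻¹ * u)) =
        cs.length (X.delta c e) + cs.length ((X.delta c e)⁻¹ * u) := by
      rw [mul_inv_cancel_left]; exact hve
    obtain ⟨h3, h4⟩ := cs.pre_mul h2 h1
    rw [mul_inv_cancel_left, ← X.delta_eq_mul_of_length h3] at h4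
    exact h4

theorem Desc.join_of_preBall (hR : X.ConvSeq ξ R) {c : X.Chamber} {u : W} (n : ℕ)
    {x z z' : X.Res} (hx : Desc ξ (X.chRes c) x)
    (hn : ∃ f ∈ x.1, cs.length u ≤ X.gdist c f + n) (h : Desc ξ x z) (h' : Desc ξ x z')
    (hz : z.1 ⊆ X.preBall c u) (hz' : z'.1 ⊆ X.preBall c u) :
    ∃ g, Desc ξ z g ∧ Desc ξ z' g ∧ g.1 ⊆ X.preBall c u := by
  induction n generalizing x z z' with
  | zero | succ n ih =>
    obtain rfl | ⟨_, ⟨σ, hσ, rfl⟩, hne, hd⟩ := Desc.exists_ne h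
    · exact ⟨z', h', .refl, hz'⟩
    obtain rfl | ⟨_, ⟨σ', hσ', rfl⟩, hne', hd'⟩ := Desc.exists_ne h'
    · exact ⟨z, .refl, h, hz⟩
    have hxx := Desc.fixed hR hx (xi_chRes hR c)
    obtain ⟨J, -, -, hJ⟩ := x.exists_type
    obtain ⟨s, τ, hτ, hxτ, hτσ, hτne⟩ := exists_step hR hxx hJ hσ hne
    obtain ⟨t, τ', hτ', hxτ', hτσ', hτne'⟩ := exists_step hR hxx hJ hσ' hne'
    obtain ⟨e, he, hen⟩ := hn
    have key : ∀ (τ : X.Res) (s : B), (∀ e ∈ x.1, τ.1 = X.residue (insert s J) e) → x.1 ⊆ τ.1 →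
        ξ τ ≠ x → ∃ f ∈ (ξ τ).1, X.gdist c e < X.gdist c f := by
      intro τ s hs hxs hns
      obtain ⟨f, hf, hg, hinv⟩ := exists_isLeftInversion hR hxx he (hJ e he) (hs e he) hxs hns
      have h1 := gate_mem_icc_of_mem_xi' hR (Desc.mem_Qseq hR hx) hxs hf
      rw [hg] at h1
      refine ⟨f, hf, ?_⟩
      have h2 : X.gdist e f ≠ 0 := fun h0 => by
        rw [gdist, cs.length_eq_zero_iff] at h0
        rw [h0] at hinv
        exact cs.not_isLeftInversion_one _ hinv
      have h3 : X.gdist c f = X.gdist c e + X.gdist e f := h1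
      omega
    have ha : Desc ξ (X.chRes c) (ξ τ) := hx.tail ⟨τ, hxτ, rfl⟩
    have hb : Desc ξ (X.chRes c) (ξ τ') := hx.tail ⟨τ', hxτ', rfl⟩
    have haz : Desc ξ (ξ τ) z := .head ⟨σ, (xi_subset hR τ).trans hτσ, rfl⟩ hd
    have hbz : Desc ξ (ξ τ') z' := .head ⟨σ', (xi_subset hR τ').trans hτσ', rfl⟩ hd'
    have hau := Desc.subset_preBall hR ha haz hz
    have hbu := Desc.subset_preBall hR hb hbz hz'
    obtain ⟨f, hf, hfe⟩ := key τ s hτ hxτ hτne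
    first
    | have h1 : cs.length u = _ + _ := hau hf
      have h2 : X.gdist c f = cs.length (X.delta c f) := rfl
      omega
    | obtain ⟨f', hf', hfe'⟩ := key τ' t hτ' hxτ' hτne'
      obtain ⟨q, hq, hq', hqu⟩ :=
        exists_move_move hR hx hJ hτ hτ' hxτ hxτ' hτne hτne' hau hbu
      obtain ⟨g₁, h1, h1', hg₁⟩ := ih ha ⟨f, hf, by omega⟩ haz (.single hq) hz hqu
      obtain ⟨g₂, h2, h2', hg₂⟩ := ih hb ⟨f', hf', by omega⟩ (.single hq') hbz hqu hz'
      obtain ⟨f₂, hf₂, hp⟩ := Desc.exists_pre hR ha (.single hq) hf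
      have hle : X.gdist c f ≤ X.gdist c f₂ := by
        rw [CoxeterSystem.Pre] at hp; rw [gdist, gdist]; omega
      obtain ⟨g, h3, h3', hg⟩ := ih (ha.tail hq) ⟨f₂, hf₂, by omega⟩ h1' h2 hg₁ hg₂
      exact ⟨g, h1.trans h3, h2'.trans h3', hg⟩

theorem exists_mem_icc_of_projRes_eq {c : X.Chamber} {z S : X.Res}
    (h : z ∈ X.conv2 (X.chRes c) S) (h' : X.projRes z S = z) {f : X.Chamber} (hf : f ∈ z.1) :
    ∃ D ∈ S.1, f ∈ X.icc c D := by
  rw [← h', mem_projRes] at hf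
  obtain ⟨D, hD, rfl⟩ := hf
  obtain ⟨E, hE, hE'⟩ := exists_mem_icc_of_mem_conv2 h (C := c) rfl hD
  exact ⟨D, hD, icc_symm (icc_trans (icc_symm hE') (gate_mem_icc z.isRes hE))⟩

theorem Desc.eventually (hR : X.ConvSeq ξ R) {c : X.Chamber} {z : X.Res}
    (h : Desc ξ (X.chRes c) z) :
    ∀ᶠ m in atTop, z ∈ X.conv2 (X.chRes c) (R m) ∧ X.projRes z (R m) = z := by
  filter_upwards [Bldg.mem_Qseq.1 (Desc.mem_Qseq hR h), convSeq_iff.1 hR z] with m h1 h2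
  exact ⟨h1, h2.trans (Desc.fixed hR h (xi_chRes hR c))⟩

/-- Any two residues reached from a chamber have a common successor. -/
theorem Desc.join (hR : X.ConvSeq ξ R) {c : X.Chamber} {z z' : X.Res}
    (h : Desc ξ (X.chRes c) z) (h' : Desc ξ (X.chRes c) z') :
    ∃ g, Desc ξ z g ∧ Desc ξ z' g := by
  obtain ⟨m, ⟨h1, h2⟩, h3, h4⟩ := ((Desc.eventually hR h).and (Desc.eventually hR h')).exists
  obtain ⟨u, hu⟩ := exists_forall_pre (R m) c
  have key : ∀ z : X.Res, z ∈ X.conv2 (X.chRes c) (R m) → X.projRes z (R m) = z →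
      z.1 ⊆ X.preBall c u := by
    intro z h1 h2 f hf
    obtain ⟨D, hD, hfD⟩ := exists_mem_icc_of_projRes_eq h1 h2 hf
    exact cs.pre_trans (pre_of_mem_icc hfD) (hu D hD)
  obtain ⟨g, hg, hg', -⟩ := Desc.join_of_preBall hR (cs.length u) (x := X.chRes c) .refl
    ⟨c, rfl, by omega⟩ h h' (key z h1 h2) (key z' h3 h4)
  exact ⟨g, hg, hg'⟩

theorem join_chRes (hR : X.ConvSeq ξ R) (c d : X.Chamber) :
    ∃ g, Desc ξ (X.chRes c) g ∧ Desc ξ (X.chRes d) g := by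
  have hm : X.delta c d ∈ cs.par (Set.univ : Set B) := by rw [par_univ]; trivial
  refine X.gallery_induction (I := Set.univ)
    (p := fun c d => ∃ g, Desc ξ (X.chRes c) g ∧ Desc ξ (X.chRes d) g) ?_ ?_ hm
  · exact fun c => ⟨_, .refl, .refl⟩
  · rintro c d e i - hi - - ⟨g, hd, he⟩
    have hsph : SphType cs {i} := cs.sphType_of_descents (u := cs.simple i) (by
      rintro l rfl
      exact cs.isLeftInversion_simple_self l)
    let σ : X.Res := ⟨X.residue {i} c, _, c, hsph, rfl⟩
    have h1 : Move ξ (X.chRes c) (ξ σ) := ⟨σ, by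
      rw [chRes_val, Set.singleton_subset_iff]
      exact X.self_mem_residue _ _, rfl⟩
    have h2 : Move ξ (X.chRes d) (ξ σ) := ⟨σ, by
      rw [chRes_val, Set.singleton_subset_iff]
      change X.delta c d ∈ cs.par {i}
      rw [hi]
      exact cs.simple_mem_par rfl, rfl⟩
    obtain ⟨g', h3, h4⟩ := Desc.join hR (.single h2) hd
    exact ⟨g', .head h1 h3, he.trans h4⟩

theorem exists_desc_mem_Qseq (hR : X.ConvSeq ξ R) (c : X.Chamber) (y : X.Res) :
    ∃ z, Desc ξ (X.chRes c) z ∧ z ∈ X.Qseq y R := by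
  obtain ⟨d, hd⟩ := (ξ y).nonempty
  obtain ⟨g, hc, hg⟩ := join_chRes hR c d
  have h1 : Move ξ (X.chRes d) (ξ y) := ⟨y, by
    rw [chRes_val, Set.singleton_subset_iff]
    exact xi_subset hR y hd, rfl⟩
  obtain ⟨z, hz, hz'⟩ := Desc.join hR hg (.single h1)
  exact ⟨z, hc.trans hz, mem_Qseq_trans (xi_mem_Qseq hR subset_rfl) (Desc.mem_Qseq hR hz')⟩

theorem finite_setOf_projRes_eq (c : X.Chamber) (S : X.Res) :
    {z : X.Res | z ∈ X.conv2 (X.chRes c) S ∧ X.projRes z S = z}.Finite := by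
  obtain ⟨D, hD⟩ := S.nonempty
  obtain ⟨u, hu⟩ := exists_forall_pre S c
  have hfin : (X.icc c D).Finite := by
    refine Set.Finite.of_finite_image (f := X.delta c)
      ((cs.finite_setOf_pre (X.delta c D)).subset ?_)
      fun E hE F hF h => eq_of_mem_icc hE hF h
    rintro _ ⟨E, hE, rfl⟩
    exact pre_of_mem_icc hE
  refine Set.Finite.of_finite_image (f := fun z : X.Res => (X.gate z.1 c, X.delta c '' z.1))
    ((hfin.prod (cs.finite_setOf_pre u).finite_subsets).subset ?_) ?_
  · rintro _ ⟨z, ⟨h, h'⟩, rfl⟩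
    refine ⟨gate_mem_icc_of_mem_conv2 h rfl hD, ?_⟩
    rintro _ ⟨f, hf, rfl⟩
    obtain ⟨E, hE, hfE⟩ := exists_mem_icc_of_projRes_eq h h' hf
    exact cs.pre_trans (pre_of_mem_icc hfE) (hu E hE)
  · have key : ∀ z z' : X.Res, X.gate z.1 c = X.gate z'.1 c →
        X.delta c '' z.1 ⊆ X.delta c '' z'.1 → z.1 ⊆ z'.1 := by
      intro z z' hg hi f hf
      obtain ⟨f', hf', hff⟩ := hi ⟨f, hf, rfl⟩
      obtain ⟨K, -, -, hK⟩ := z'.exists_type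
      have h1 := delta_eq_inv_mul (gate_mem_icc z.isRes hf (C := c))
      have h2 := delta_eq_inv_mul (gate_mem_icc z'.isRes hf' (C := c))
      have h3 := hK _ (gate_mem z'.isRes c)
      rw [h3, mem_residue] at hf'
      rw [h3, mem_residue, ← hg, h1, ← hff, hg, ← h2]
      exact hf'
    rintro z - z' - h
    obtain ⟨h1, h2⟩ := Prod.mk.inj h
    exact Res.ext' ((key _ _ h1 h2.subset).antisymm (key _ _ h1.symm h2.symm.subset))

theorem countable_setOf_desc (hR : X.ConvSeq ξ R) (c : X.Chamber) :
    {z : X.Res | Desc ξ (X.chRes c) z}.Countable := by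
  refine (Set.countable_iUnion fun m =>
    (finite_setOf_projRes_eq c (R m)).countable).mono fun z hz => ?_
  obtain ⟨m, hm⟩ := (Desc.eventually hR hz).exists
  exact Set.mem_iUnion.2 ⟨m, hm⟩

theorem exists_desc_seq (hR : X.ConvSeq ξ R) (c : X.Chamber) :
    ∃ x : ℕ → X.Res, (∀ n, Desc ξ (X.chRes c) (x n)) ∧
      ∀ y : X.Res, ∀ᶠ n in atTop, x n ∈ X.Qseq y R := by
  obtain ⟨zs, hzs⟩ := (countable_setOf_desc hR c).exists_eq_range ⟨X.chRes c, .refl⟩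
  have hz : ∀ n, Desc ξ (X.chRes c) (zs n) := fun n => by
    have : zs n ∈ {z : X.Res | Desc ξ (X.chRes c) z} := hzs ▸ ⟨n, rfl⟩
    exact this
  choose g hg hg' using fun (x : {z : X.Res // Desc ξ (X.chRes c) z}) n =>
    Desc.join hR x.2 (hz n)
  let x : ℕ → {z : X.Res // Desc ξ (X.chRes c) z} := fun n =>
    Nat.rec ⟨X.chRes c, .refl⟩ (fun n a => ⟨g a n, a.2.trans (hg a n)⟩) n
  have hx : ∀ n, (x (n + 1)).1 = g (x n) n := fun _ => rfl
  refine ⟨fun n => (x n).1, fun n => (x n).2, fun y => ?_⟩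
  obtain ⟨z, h1, h2⟩ := exists_desc_mem_Qseq hR c y
  obtain ⟨n, rfl⟩ : z ∈ Set.range zs := hzs ▸ h1
  filter_upwards [eventually_ge_atTop (n + 1)] with k hk
  have h3 : Desc ξ (zs n) (x k).1 := by
    induction k, hk using Nat.le_induction with
    | base => rw [hx]; exact hg' _ _
    | succ k _ ih => rw [hx]; exact ih.trans (hg _ _)
  exact mem_Qseq_trans h2 (Desc.mem_Qseq hR h3)

theorem exists_isApartment (hR : X.ConvSeq ξ R) {c : X.Chamber} {x : ℕ → X.Res}
    (hx : ∀ n, Desc ξ (X.chRes c) (x n)) :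
    ∃ A, X.IsApartment A ∧ ∀ n, X.LiesIn (x n) A := by
  obtain ⟨α, hα, h⟩ := exists_isApartMap (X := X)
    (Γ := Set.range fun n => (X.delta c (X.gate (x n).1 c), X.gate (x n).1 c))
    (Set.range_nonempty _) (by
      rintro _ ⟨n, rfl⟩ _ ⟨k, rfl⟩
      obtain ⟨m, hn, hk⟩ := ((Desc.eventually hR (hx n)).and (Desc.eventually hR (hx k))).exists
      obtain ⟨D, hD⟩ := (R m).nonempty
      exact delta_of_mem_icc (gate_mem_icc_of_mem_conv2 hn.1 (C := c) rfl hD)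
        (gate_mem_icc_of_mem_conv2 hk.1 (C := c) rfl hD))
  exact ⟨_, ⟨α, hα, rfl⟩, fun n => ⟨_, gate_mem (x n).isRes c, _, h _ ⟨n, rfl⟩⟩⟩

end Sector

end Bldg

/-- for every `ξ ∈ Cr(X)` there is a sequence `(x_n)` of residues
with `ξ(x_n) = x_n` which penetrates and eventually remains in every sector
pointing to `ξ`; every such sequence converges to `ξ`; in particular every point
of `Cr(X)` is the limit of a sequence of residues lying in a common apartment. -/
theorem statement13 {cs : CoxeterSystem M W} (X : Bldg cs)
    (ξ : X.Res → X.Res) (hξ : ξ ∈ X.Cr) (hseq : ∃ R : ℕ → X.Res, X.ConvSeq ξ R) :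
    (∃ x : ℕ → X.Res, (∀ n, ξ (x n) = x n) ∧
      ∀ y : X.Res, ∃ N : ℕ, ∀ n > N, x n ∈ X.Qsector y ξ) ∧
    (∀ x : ℕ → X.Res, (∀ n, ξ (x n) = x n) →
      (∀ y : X.Res, ∃ N : ℕ, ∀ n > N, x n ∈ X.Qsector y ξ) →
      X.ConvSeq ξ x) ∧
    ∃ A : Set X.Chamber, X.IsApartment A ∧
      ∃ R : ℕ → X.Res, (∀ n, X.LiesIn (R n) A) ∧ X.ConvSeq ξ R := by
  have hR : X.ConvSeq ξ (Classical.epsilon (X.ConvSeq ξ)) := Classical.epsilon_spec hseq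
  obtain ⟨c⟩ := X.chamber_nonempty
  obtain ⟨x, hx, hxQ⟩ := Bldg.exists_desc_seq hR c
  have hfix : ∀ n, ξ (x n) = x n := fun n => Bldg.Desc.fixed hR (hx n) (Bldg.xi_chRes hR c)
  obtain ⟨A, hA, hAx⟩ := Bldg.exists_isApartment hR hx
  refine ⟨⟨x, hfix, fun y => ?_⟩, fun z hz h => ?_,
    A, hA, x, hAx, Bldg.convSeq_of_eventually_mem_Qseq hR hfix hxQ⟩
  · obtain ⟨N, hN⟩ := eventually_atTop.1 (hxQ y)
    exact ⟨N, fun n hn => hN n hn.le⟩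
  · refine Bldg.convSeq_of_eventually_mem_Qseq hR hz fun y => ?_
    obtain ⟨N, hN⟩ := h y
    filter_upwards [eventually_gt_atTop N] with n hn using hN n hn
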